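/- arXiv:1111.6379 — 2 statements merged into one kernel-verified Lean document; each statement's English description precedes it below -/
import Mathlib

section
/- Let γ ∈ [0,1), let K satisfy the standing kernel assumptions, let ρ ∈ (γ,1), β = 1/(ρ−γ). If h is a nonnegative Radon measure on [0,∞) satisfying ∫_{[0,R]} dh ≤ R^{1−ρ} for all R > 0 and the weak stationary identity ∫ ψ'(x)(∫_0^x ∫_{x−y}^∞ (K(y,z)/z) dh(z) dh(y)) dx − β ∫ (xψ(x))' dh(x) + βρ ∫ ψ(x) dh(x) = 0 for all ψ ∈ C_c^1([0,∞)), then on (0,∞) the measure h is absolutely continuous with a density that is a continuous function. -/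
open MeasureTheory Real Set Filter Topology

noncomputable section

namespace Smol

/-- Standing assumptions on the coagulation kernel `K`: continuity on `(0,∞)²`, symmetry,
nonnegativity, homogeneity of degree `γ` and the growth bound `K(x,y) ≤ C(x^γ + y^γ)`. -/
structure KernelHyp (K : ℝ → ℝ → ℝ) (γ C : ℝ) : Prop where
  cont : ContinuousOn (fun p : ℝ × ℝ => K p.1 p.2) (Ioi (0:ℝ) ×ˢ Ioi (0:ℝ))
  symm : ∀ x y : ℝ, 0 < x → 0 < y → K x y = K y x
  nonneg : ∀ x y : ℝ, 0 < x → 0 < y → 0 ≤ K x y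
  homog : ∀ a x y : ℝ, 0 < a → 0 < x → 0 < y → K (a * x) (a * y) = a ^ γ * K x y
  growth : ∀ x y : ℝ, 0 < x → 0 < y → K x y ≤ C * (x ^ γ + y ^ γ)

/-- `I[h](x) = ∫_0^x ∫_{x-y}^∞ (K(y,z)/z) dh(z) dh(y)` for a measure `h`. -/
def Imeas (K : ℝ → ℝ → ℝ) (μ : Measure ℝ) (x : ℝ) : ℝ :=
  ∫ y in Ioc (0:ℝ) x, (∫ z in Ici (x - y), K y z / z ∂μ) ∂μ

open scoped ENNReal

/-- The power `t ^ (-ρ)` on `[0, r]`, equal to `∞` at the origin and `0` outside `[0, r]`. -/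
def truncPow (ρ r t : ℝ) : ℝ≥0∞ :=
  (Icc 0 r).indicator (fun s => ENNReal.ofReal s ^ (-ρ)) t

@[fun_prop]
lemma measurable_truncPow (ρ r : ℝ) : Measurable (truncPow ρ r) :=
  (ENNReal.measurable_ofReal.pow_const _).indicator measurableSet_Icc

lemma lintegral_truncPow {ρ r : ℝ} (hρ : ρ < 1) (hr : 0 ≤ r) :
    ∫⁻ t, truncPow ρ r t = ENNReal.ofReal (r ^ (1 - ρ) / (1 - ρ)) := by
  have h_int : IntegrableOn (fun t : ℝ => t ^ (-ρ)) (Ioc 0 r) :=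
    (intervalIntegrable_iff_integrableOn_Ioc_of_le hr).1
      (intervalIntegral.intervalIntegrable_rpow' (by linarith))
  calc ∫⁻ t, truncPow ρ r t
      = ∫⁻ t in Ioc 0 r, ENNReal.ofReal t ^ (-ρ) := by
        simp only [truncPow]
        rw [lintegral_indicator measurableSet_Icc, restrict_Ioc_eq_restrict_Icc]
    _ = ∫⁻ t in Ioc 0 r, ENNReal.ofReal (t ^ (-ρ)) :=
        setLIntegral_congr_fun measurableSet_Ioc
          fun t ht => ENNReal.ofReal_rpow_of_pos ht.1
    _ = ENNReal.ofReal (∫ t in Ioc 0 r, t ^ (-ρ)) := by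
        rw [ofReal_integral_eq_lintegral_ofReal h_int]
        filter_upwards [ae_restrict_mem measurableSet_Ioc] with t ht
        exact rpow_nonneg ht.1.le _
    _ = _ := by
        rw [← intervalIntegral.integral_of_le hr, integral_rpow (Or.inl (by linarith)),
          show -ρ + 1 = 1 - ρ by ring, zero_rpow (by linarith), sub_zero]

/-- A measure concentrated on `[0, ∞)` with `μ [0, R] ≤ R ^ (1 - ρ)` for every `R > 0`. -/
structure PowerGrowth (μ : Measure ℝ) (ρ : ℝ) : Prop where
  supp : μ (Iio 0) = 0
  growth : ∀ R > (0 : ℝ), μ (Icc 0 R) ≤ ENNReal.ofReal (R ^ (1 - ρ))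

section PowerGrowth

variable {μ : Measure ℝ} {ρ : ℝ}

lemma PowerGrowth.Iic_le (h : PowerGrowth μ ρ) {R : ℝ} (hR : 0 < R) :
    μ (Iic R) ≤ ENNReal.ofReal (R ^ (1 - ρ)) := by
  rw [← Iio_union_Icc_eq_Iic hR.le]
  refine (measure_union_le _ _).trans ?_
  rw [h.supp, zero_add]
  exact h.growth R hR

lemma PowerGrowth.Iic_lt_top (h : PowerGrowth μ ρ) (R : ℝ) : μ (Iic R) < ∞ := by
  refine lt_of_le_of_lt (measure_mono (Iic_subset_Iic.2 (le_max_left R 1))) ?_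
  exact (h.Iic_le (lt_max_of_lt_right one_pos)).trans_lt ENNReal.ofReal_lt_top

lemma PowerGrowth.isLocallyFiniteMeasure (h : PowerGrowth μ ρ) : IsLocallyFiniteMeasure μ :=
  ⟨fun x => ⟨Iic (x + 1), Iic_mem_nhds (by linarith), h.Iic_lt_top _⟩⟩

lemma PowerGrowth.Iic_zero (h : PowerGrowth μ ρ) (hρ : ρ < 1) : μ (Iic 0) = 0 := by
  have hlim : Tendsto (fun R : ℝ => ENNReal.ofReal (R ^ (1 - ρ))) (𝓝[>] 0) (𝓝 0) := by
    have := ((Real.continuous_rpow_const (q := 1 - ρ) (by linarith)).tendsto 0).mono_left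
      (nhdsWithin_le_nhds (s := Ioi 0))
    rw [zero_rpow (by linarith)] at this
    simpa using ENNReal.tendsto_ofReal this
  refine le_antisymm (ge_of_tendsto hlim ?_) zero_le
  filter_upwards [self_mem_nhdsWithin] with R hR
  exact (measure_mono (Iic_subset_Iic.2 (le_of_lt hR))).trans (h.Iic_le hR)

lemma PowerGrowth.ae_pos (h : PowerGrowth μ ρ) (hρ : ρ < 1) : ∀ᵐ x ∂μ, 0 < x := by
  rw [ae_iff]
  simpa [← Iic_def] using h.Iic_zero hρ

lemma PowerGrowth.lintegral_Ici_rpow_le (h : PowerGrowth μ ρ) {s : ℝ} (hs : 0 ≤ s)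
    (hsρ : 1 - ρ < s) :
    ∃ c : ℝ, 0 ≤ c ∧ ∀ t > 0,
      ∫⁻ z in Ici t, ENNReal.ofReal (z ^ (-s)) ∂μ ≤ ENNReal.ofReal (c * t ^ (1 - ρ - s)) := by
  set q : ℝ := 2 ^ (1 - ρ - s) with hq
  have hq0 : 0 < q := rpow_pos_of_pos two_pos _
  have hq1 : q < 1 := rpow_lt_one_of_one_lt_of_neg one_lt_two (by linarith)
  refine ⟨2 ^ (1 - ρ) * (1 - q)⁻¹, by have := sub_pos.2 hq1; positivity, fun t ht => ?_⟩
  have hcover : Ici t ⊆ ⋃ n : ℕ, Ico (2 ^ n * t) (2 ^ (n + 1) * t) := by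
    intro z hz
    obtain ⟨n, hn1, hn2⟩ := exists_nat_pow_near ((one_le_div ht).2 hz) one_lt_two
    exact mem_iUnion.2 ⟨n, (le_div_iff₀ ht).1 hn1, (div_lt_iff₀ ht).1 hn2⟩
  have hpiece (n : ℕ) : ∫⁻ z in Ico (2 ^ n * t) (2 ^ (n + 1) * t), ENNReal.ofReal (z ^ (-s)) ∂μ
      ≤ ENNReal.ofReal (2 ^ (1 - ρ) * t ^ (1 - ρ - s) * q ^ n) := by
    have hpos : 0 < 2 ^ n * t := by positivity
    calc _ ≤ ∫⁻ _ in Ico (2 ^ n * t) (2 ^ (n + 1) * t), ENNReal.ofReal ((2 ^ n * t) ^ (-s)) ∂μ := by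
          refine setLIntegral_mono measurable_const fun z hz => ENNReal.ofReal_le_ofReal ?_
          exact rpow_le_rpow_of_nonpos hpos hz.1 (by linarith)
      _ ≤ ENNReal.ofReal ((2 ^ n * t) ^ (-s)) * ENNReal.ofReal ((2 ^ (n + 1) * t) ^ (1 - ρ)) := by
          rw [setLIntegral_const]
          gcongr
          refine (measure_mono ?_).trans (h.Iic_le (by positivity))
          exact fun z hz => hz.2.le
      _ = _ := by
          rw [← ENNReal.ofReal_mul (by positivity)]
          congr 1
          rw [show (2 : ℝ) ^ (n + 1) * t = 2 * (2 ^ n * t) by ring,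
            mul_rpow two_pos.le hpos.le, mul_left_comm, ← rpow_add hpos,
            show -s + (1 - ρ) = 1 - ρ - s by ring, mul_rpow (by positivity) ht.le,
            ← rpow_natCast 2 n, ← rpow_mul two_pos.le, mul_comm (n : ℝ), rpow_mul two_pos.le,
            rpow_natCast]
          ring
  calc _ ≤ ∑' n : ℕ, ∫⁻ z in Ico (2 ^ n * t) (2 ^ (n + 1) * t), ENNReal.ofReal (z ^ (-s)) ∂μ :=
        (lintegral_mono_set hcover).trans (lintegral_iUnion_le _ _)
    _ ≤ ∑' n : ℕ, ENNReal.ofReal (2 ^ (1 - ρ) * t ^ (1 - ρ - s) * q ^ n) :=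
        ENNReal.tsum_le_tsum hpiece
    _ = ENNReal.ofReal (∑' n : ℕ, 2 ^ (1 - ρ) * t ^ (1 - ρ - s) * q ^ n) :=
        (ENNReal.ofReal_tsum_of_nonneg (fun n => by positivity)
          ((summable_geometric_of_lt_one hq0.le hq1).mul_left _)).symm
    _ = _ := by
        rw [tsum_mul_left, tsum_geometric_of_lt_one hq0.le hq1]
        congr 1
        ring

end PowerGrowth

/-- The `ℝ≥0∞`-valued kernel `K(y,z)/z` on `(0,∞)²`, extended by zero. -/
def coagKer (K : ℝ → ℝ → ℝ) : ℝ × ℝ → ℝ≥0∞ :=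
  (Ioi (0 : ℝ) ×ˢ Ioi (0 : ℝ)).indicator fun p => ENNReal.ofReal (K p.1 p.2 / p.2)

/-- The `ℝ≥0∞`-valued flux `∫_0^x ∫_{x-y}^∞ k(y,z) dμ(z) dμ(y)`. -/
def flux (μ : Measure ℝ) (k : ℝ × ℝ → ℝ≥0∞) (x : ℝ) : ℝ≥0∞ :=
  ∫⁻ y in Ioc 0 x, ∫⁻ z in Ici (x - y), k (y, z) ∂μ ∂μ

section Flux

variable {μ : Measure ℝ} {k : ℝ × ℝ → ℝ≥0∞}

lemma measurable_lintegral_Ici_sub [SFinite μ] (hk : Measurable k) (x : ℝ) :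
    Measurable fun y => ∫⁻ z in Ici (x - y), k (y, z) ∂μ := by
  have hS : MeasurableSet {p : ℝ × ℝ | x - p.1 ≤ p.2} :=
    measurableSet_le (by fun_prop) (by fun_prop)
  have := (hk.indicator hS).lintegral_prod_right' (ν := μ)
  convert this using 2 with y
  rw [← lintegral_indicator measurableSet_Ici]
  rfl

lemma flux_eq_lintegral_prod [SFinite μ] (hk : Measurable k) (hk0 : ∀ p, p.1 ≤ 0 → k p = 0)
    (x : ℝ) :
    flux μ k x
      = ∫⁻ p, {p : ℝ × ℝ | p.1 ≤ x ∧ x ≤ p.1 + p.2}.indicator k p ∂μ.prod μ := by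
  have hS : MeasurableSet {p : ℝ × ℝ | p.1 ≤ x ∧ x ≤ p.1 + p.2}  := by
    rw [ofPred_and]
    exact (measurableSet_le (by fun_prop) (by fun_prop)).inter
      (measurableSet_le (by fun_prop) (by fun_prop))
  rw [lintegral_prod _ (hk.indicator hS).aemeasurable, flux,
    ← lintegral_indicator measurableSet_Ioc]
  refine lintegral_congr fun y => ?_
  by_cases hy : y ∈ Ioc 0 x
  · rw [indicator_of_mem hy, ← lintegral_indicator measurableSet_Ici]
    refine lintegral_congr fun z => ?_
    by_cases hz : x - y ≤ z
    · rw [indicator_of_mem (show z ∈ Ici (x - y) from hz), indicator_of_mem]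
      exact ⟨hy.2, by linarith⟩
    · rw [indicator_of_notMem (show z ∉ Ici (x - y) from hz), indicator_of_notMem]
      exact fun h => hz (by linarith [h.2])
  · rw [indicator_of_notMem hy]
    symm
    rw [lintegral_eq_zero_iff (by fun_prop (disch := assumption))]
    refine Eventually.of_forall fun z => ?_
    by_cases hy0 : y ≤ 0
    · exact indicator_apply_eq_zero.2 fun _ => hk0 _ hy0
    · exact indicator_of_notMem (fun h => hy ⟨not_le.1 hy0, h.1⟩) _

lemma measurable_flux [SFinite μ] (hk : Measurable k) (hk0 : ∀ p, p.1 ≤ 0 → k p = 0) :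
    Measurable (flux μ k) := by
  have hS : MeasurableSet {q : ℝ × (ℝ × ℝ) | q.2.1 ≤ q.1 ∧ q.1 ≤ q.2.1 + q.2.2}  := by
    rw [ofPred_and]
    exact (measurableSet_le (by fun_prop) (by fun_prop)).inter
      (measurableSet_le (by fun_prop) (by fun_prop))
  have := ((hk.comp measurable_snd).indicator hS).lintegral_prod_right' (ν := μ.prod μ)
  convert this using 1
  funext x
  rw [flux_eq_lintegral_prod hk hk0]
  rfl

end Flux

section Kernel

variable {K : ℝ → ℝ → ℝ} {γ C ρ : ℝ} {μ : Measure ℝ}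

lemma coagKer_of_pos {y z : ℝ} (hy : 0 < y) (hz : 0 < z) :
    coagKer K (y, z) = ENNReal.ofReal (K y z / z) :=
  indicator_of_mem (show (y, z) ∈ Ioi (0 : ℝ) ×ˢ Ioi (0 : ℝ) from ⟨hy, hz⟩) _

lemma coagKer_of_fst_nonpos (p : ℝ × ℝ) (hp : p.1 ≤ 0) : coagKer K p = 0 :=
  indicator_of_notMem (fun h => not_lt.2 hp h.1) _

lemma coagKer_lt_top (p : ℝ × ℝ) : coagKer K p < ∞ := by
  unfold coagKer
  by_cases hp : p ∈ Ioi (0 : ℝ) ×ˢ Ioi (0 : ℝ) <;> simp [hp]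

lemma KernelHyp.measurable_coagKer (hK : KernelHyp K γ C) : Measurable (coagKer K) := by
  classical
  rw [coagKer, ← piecewise_eq_indicator]
  refine ContinuousOn.measurable_piecewise ?_ continuousOn_const
    (measurableSet_Ioi.prod measurableSet_Ioi)
  exact ENNReal.continuous_ofReal.comp_continuousOn
    (hK.cont.div continuousOn_snd fun p hp => ne_of_gt hp.2)

lemma KernelHyp.lintegral_Ici_coagKer_le (hK : KernelHyp K γ C) (hγ : γ ∈ Ico (0 : ℝ) 1)
    (hC : 0 < C) (hρ : ρ ∈ Ioo γ 1) (hμ : PowerGrowth μ ρ) {R : ℝ} (hR : 0 < R) :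
    ∃ c : ℝ, 0 < c ∧ ∀ y ∈ Ioc 0 R, ∀ t ∈ Icc 0 R,
      ∫⁻ z in Ici t, coagKer K (y, z) ∂μ ≤ ENNReal.ofReal c * truncPow ρ R t := by
  obtain ⟨c₀, hc₀, hle⟩ := hμ.lintegral_Ici_rpow_le (s := 1 - γ) (by linarith [hγ.2])
    (by linarith [hρ.1])
  have hRγ : 0 < R ^ γ := rpow_pos_of_pos hR _
  refine ⟨2 * C * R ^ γ * c₀ + 1, by positivity, fun y hy t ht => ?_⟩
  rw [truncPow, indicator_of_mem ht]
  rcases ht.1.eq_or_lt with rfl | ht0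
  · rw [ENNReal.ofReal_zero, ENNReal.zero_rpow_of_neg (by linarith [hγ.1, hρ.1]),
      ENNReal.mul_top (by simp; positivity)]
    exact le_top
  have hpt (z : ℝ) (hz : z ∈ Ici t) : coagKer K (y, z)
      ≤ ENNReal.ofReal (2 * C * R ^ γ * t ^ (-γ)) * ENNReal.ofReal (z ^ (-(1 - γ))) := by
    have hz0 : 0 < z := ht0.trans_le hz
    rw [coagKer_of_pos hy.1 hz0, ← ENNReal.ofReal_mul (by positivity)]
    refine ENNReal.ofReal_le_ofReal ?_
    have h1 : 1 ≤ t ^ (-γ) * z ^ γ := by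
      rw [rpow_neg ht0.le, ← div_eq_inv_mul, ← div_rpow hz0.le ht0.le]
      exact one_le_rpow ((one_le_div ht0).2 hz) hγ.1
    have h2 : y ^ γ ≤ R ^ γ * (t ^ (-γ) * z ^ γ) :=
      (rpow_le_rpow hy.1.le hy.2 hγ.1).trans (le_mul_of_one_le_right hRγ.le h1)
    have h3 : z ^ γ ≤ R ^ γ * (t ^ (-γ) * z ^ γ) := by
      rw [← mul_assoc]
      refine le_mul_of_one_le_left (by positivity) ?_
      rw [rpow_neg ht0.le, ← div_eq_mul_inv, ← div_rpow hR.le ht0.le]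
      exact one_le_rpow ((one_le_div ht0).2 ht.2) hγ.1
    rw [div_le_iff₀ hz0]
    have h4 : z ^ (-(1 - γ)) * z = z ^ γ := by
      rw [← rpow_add_one hz0.ne']
      congr 1
      ring
    calc K y z ≤ C * (y ^ γ + z ^ γ) := hK.growth y z hy.1 hz0
      _ ≤ C * (R ^ γ * (t ^ (-γ) * z ^ γ) + R ^ γ * (t ^ (-γ) * z ^ γ)) := by gcongr
      _ = _ := by rw [mul_assoc (2 * C * R ^ γ * t ^ (-γ)), h4]; ring
  calc _ ≤ ∫⁻ z in Ici t,
        ENNReal.ofReal (2 * C * R ^ γ * t ^ (-γ)) * ENNReal.ofReal (z ^ (-(1 - γ))) ∂μ :=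
        setLIntegral_mono (by fun_prop) hpt
    _ = ENNReal.ofReal (2 * C * R ^ γ * t ^ (-γ))
        * ∫⁻ z in Ici t, ENNReal.ofReal (z ^ (-(1 - γ))) ∂μ :=
        lintegral_const_mul _ (by fun_prop)
    _ ≤ ENNReal.ofReal (2 * C * R ^ γ * t ^ (-γ))
        * ENNReal.ofReal (c₀ * t ^ (1 - ρ - (1 - γ))) := by gcongr; exact hle t ht0
    _ = ENNReal.ofReal (2 * C * R ^ γ * c₀) * ENNReal.ofReal (t ^ (-ρ)) := by
        rw [← ENNReal.ofReal_mul (by positivity), ← ENNReal.ofReal_mul (by positivity)]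
        have : t ^ (-ρ) = t ^ (-γ) * t ^ (1 - ρ - (1 - γ)) := by
          rw [← rpow_add ht0]
          congr 1
          ring
        rw [this]
        congr 1
        ring
    _ ≤ _ := by
        rw [ENNReal.ofReal_rpow_of_pos ht0]
        gcongr
        linarith

lemma flux_coagKer_le {R c : ℝ}
    (hle : ∀ y ∈ Ioc 0 R, ∀ t ∈ Icc 0 R,
      ∫⁻ z in Ici t, coagKer K (y, z) ∂μ ≤ ENNReal.ofReal c * truncPow ρ R t)
    {x : ℝ} (hx : x ≤ R) :
    flux μ (coagKer K) x
      ≤ ENNReal.ofReal c * ∫⁻ y in Ioc 0 x, truncPow ρ R (x - y) ∂μ := by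
  rw [flux, ← lintegral_const_mul _ (by fun_prop)]
  refine setLIntegral_mono (by fun_prop) fun y hy => ?_
  exact hle y ⟨hy.1, hy.2.trans hx⟩ _ ⟨by linarith [hy.2], by linarith [hy.1]⟩

lemma PowerGrowth.lintegral_potential_lt_top (hμ : PowerGrowth μ ρ) (hρ : ρ < 1) {R : ℝ}
    (hR : 0 < R) :
    ∫⁻ x, ∫⁻ y in Iic R, truncPow ρ R (x - y) ∂μ < ∞ := by
  have := hμ.isLocallyFiniteMeasure
  calc ∫⁻ x, ∫⁻ y in Iic R, truncPow ρ R (x - y) ∂μ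
      = ∫⁻ y in Iic R, (∫⁻ x, truncPow ρ R (x - y)) ∂μ :=
        lintegral_lintegral_swap (f := fun x y => truncPow ρ R (x - y))
          (by unfold Function.uncurry; fun_prop)
    _ = ENNReal.ofReal (R ^ (1 - ρ) / (1 - ρ)) * μ (Iic R) := by
        rw [← setLIntegral_const]
        refine lintegral_congr fun y => ?_
        rw [lintegral_sub_right_eq_self (truncPow ρ R), lintegral_truncPow hρ hR.le]
    _ < ∞ := ENNReal.mul_lt_top ENNReal.ofReal_lt_top (hμ.Iic_lt_top R)

lemma KernelHyp.lintegral_flux_lt_top (hK : KernelHyp K γ C) (hγ : γ ∈ Ico (0 : ℝ) 1)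
    (hC : 0 < C) (hρ : ρ ∈ Ioo γ 1) (hμ : PowerGrowth μ ρ) {R : ℝ} (hR : 0 < R) :
    ∫⁻ x in Ioc 0 R, flux μ (coagKer K) x < ∞ := by
  obtain ⟨c, -, hle⟩ := hK.lintegral_Ici_coagKer_le hγ hC hρ hμ hR
  calc ∫⁻ x in Ioc 0 R, flux μ (coagKer K) x
      ≤ ∫⁻ x in Ioc 0 R, ENNReal.ofReal c * ∫⁻ y in Iic R, truncPow ρ R (x - y) ∂μ := by
        refine setLIntegral_mono' measurableSet_Ioc fun x hx => ?_
        refine (flux_coagKer_le hle hx.2).trans ?_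
        gcongr
        exact fun y hy => hy.2.trans hx.2
    _ ≤ ∫⁻ x, ENNReal.ofReal c * ∫⁻ y in Iic R, truncPow ρ R (x - y) ∂μ :=
        setLIntegral_le_lintegral _ _
    _ = ENNReal.ofReal c * ∫⁻ x, ∫⁻ y in Iic R, truncPow ρ R (x - y) ∂μ :=
        lintegral_const_mul' _ _ ENNReal.ofReal_ne_top
    _ < ∞ := ENNReal.mul_lt_top ENNReal.ofReal_lt_top (hμ.lintegral_potential_lt_top hρ.2 hR)

lemma KernelHyp.Imeas_eq_toReal_flux (hK : KernelHyp K γ C) (hρ : ρ < 1)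
    (hμ : PowerGrowth μ ρ) {x : ℝ} (hx : flux μ (coagKer K) x ≠ ∞) :
    Imeas K μ x = (flux μ (coagKer K) x).toReal := by
  have := hμ.isLocallyFiniteMeasure
  have hmeas := measurable_lintegral_Ici_sub (μ := μ) hK.measurable_coagKer x
  rw [flux, ← integral_toReal hmeas.aemeasurable (ae_lt_top hmeas hx), Imeas]
  refine setIntegral_congr_fun measurableSet_Ioc fun y hy => ?_
  have hk : Measurable fun z => coagKer K (y, z) :=
    hK.measurable_coagKer.comp measurable_prodMk_left
  change ∫ z in Ici (x - y), K y z / z ∂μ = (∫⁻ z in Ici (x - y), coagKer K (y, z) ∂μ).toReal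
  rw [← integral_toReal hk.aemeasurable (Eventually.of_forall fun z => coagKer_lt_top _)]
  refine integral_congr_ae (ae_restrict_of_ae ?_)
  filter_upwards [hμ.ae_pos hρ] with z hz
  rw [coagKer_of_pos hy.1 hz, ENNReal.toReal_ofReal (div_nonneg (hK.nonneg y z hy.1 hz) hz.le)]

end Kernel

lemma tendsto_rpow_div_nhdsGT_zero {ρ : ℝ} (hρ : ρ < 1) :
    Tendsto (fun δ : ℝ => ENNReal.ofReal (δ ^ (1 - ρ) / (1 - ρ))) (𝓝[>] 0) (𝓝 0) := by
  have := (((Real.continuous_rpow_const (q := 1 - ρ) (by linarith)).div_const (1 - ρ)).tendsto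
    0).mono_left (nhdsWithin_le_nhds (s := Ioi 0))
  rw [zero_rpow (by linarith), zero_div] at this
  simpa using ENNReal.tendsto_ofReal this

lemma truncPow_le_add {ρ : ℝ} (hρ : 0 ≤ ρ) (R δ t : ℝ) :
    truncPow ρ R t ≤ truncPow ρ δ t + ENNReal.ofReal δ ^ (-ρ) := by
  by_cases ht : t ∈ Icc 0 R
  · rcases le_total t δ with h | h
    · rw [truncPow, truncPow, indicator_of_mem ht,
        indicator_of_mem (show t ∈ Icc 0 δ from ⟨ht.1, h⟩)]
      exact le_self_add
    · rw [truncPow, indicator_of_mem ht]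
      refine le_add_of_le_right ?_
      rw [ENNReal.rpow_neg, ENNReal.rpow_neg]
      gcongr
  · rw [truncPow, indicator_of_notMem ht]
    exact zero_le

/-- An integrable subsolution of a Volterra equation with kernel `(x - y) ^ (-ρ)`, `ρ < 1`, is
essentially bounded. -/
lemma ae_le_of_le_volterra {G : ℝ → ℝ≥0∞} (hG : Measurable G) {ρ a R : ℝ} {A B : ℝ≥0∞}
    (hρ : ρ ∈ Ico 0 1) (hA : A ≠ ∞) (hB : B ≠ ∞) (h_int : ∫⁻ x in Ioc a R, G x ≠ ∞)
    (hle : ∀ x ∈ Ioc a R, G x ≤ A + B * ∫⁻ y in Ioc a x, truncPow ρ R (x - y) * G y) :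
    ∃ M : ℝ≥0∞, M ≠ ∞ ∧ ∀ᵐ x ∂volume.restrict (Ioc a R), G x ≤ M := by
  obtain ⟨δ, hδ, hδ0⟩ : ∃ δ : ℝ, B * ENNReal.ofReal (δ ^ (1 - ρ) / (1 - ρ)) < 1 / 2 ∧ 0 < δ := by
    have h := ENNReal.Tendsto.const_mul (a := B) (tendsto_rpow_div_nhdsGT_zero hρ.2)
      (Or.inr hB)
    rw [mul_zero] at h
    exact ((h.eventually_lt_const (by simp)).and self_mem_nhdsWithin).exists
  set b : ℝ≥0∞ := B * ENNReal.ofReal (δ ^ (1 - ρ) / (1 - ρ)) with hb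
  set N := ∫⁻ x in Ioc a R, G x with hN
  set d : ℝ≥0∞ := ENNReal.ofReal δ ^ (-ρ) with hd
  have hd_top : d ≠ ∞ := ENNReal.rpow_ne_top_of_ne_zero (by simpa using hδ0) (by simp)
  set A' : ℝ≥0∞ := A + B * (d * N) with hA'
  have hA'_top : A' ≠ ∞ :=
    ENNReal.add_ne_top.2 ⟨hA, ENNReal.mul_ne_top hB (ENNReal.mul_ne_top hd_top h_int)⟩
  have hM_top : 2 * A' ≠ ∞ := ENNReal.mul_ne_top (by simp) hA'_top
  refine ⟨2 * A', hM_top, ?_⟩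
  set u : ℝ → ℝ≥0∞ := fun x => G x - 2 * A' with hu
  have hum : Measurable u := hG.sub_const _
  have hu_le (x : ℝ) (hx : x ∈ Ioc a R) :
      u x ≤ B * ∫⁻ y in Ioc a R, truncPow ρ δ (x - y) * u y := by
    have h1 : ∫⁻ y in Ioc a x, truncPow ρ R (x - y) * G y
        ≤ (∫⁻ y in Ioc a R, truncPow ρ δ (x - y) * G y) + d * N := by
      calc _ ≤ ∫⁻ y in Ioc a R, truncPow ρ R (x - y) * G y :=
            lintegral_mono_set (Ioc_subset_Ioc_right hx.2)
        _ ≤ ∫⁻ y in Ioc a R, (truncPow ρ δ (x - y) * G y + d * G y) := by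
            refine lintegral_mono fun y => ?_
            rw [← add_mul]
            gcongr
            exact truncPow_le_add hρ.1 R δ (x - y)
        _ = _ := by
            rw [lintegral_add_left (by fun_prop), lintegral_const_mul _ hG]
    have h2 : ∫⁻ y in Ioc a R, truncPow ρ δ (x - y) * G y
        ≤ ENNReal.ofReal (δ ^ (1 - ρ) / (1 - ρ)) * (2 * A')
          + ∫⁻ y in Ioc a R, truncPow ρ δ (x - y) * u y := by
      calc _ ≤ ∫⁻ y in Ioc a R,
            (truncPow ρ δ (x - y) * (2 * A') + truncPow ρ δ (x - y) * u y) := by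
            refine lintegral_mono fun y => ?_
            rw [← mul_add]
            gcongr
            exact le_add_tsub
        _ = (∫⁻ y in Ioc a R, truncPow ρ δ (x - y) * (2 * A'))
            + ∫⁻ y in Ioc a R, truncPow ρ δ (x - y) * u y :=
            lintegral_add_left (by fun_prop) _
        _ ≤ _ := by
            gcongr
            rw [lintegral_mul_const _ (by fun_prop)]
            gcongr
            refine (setLIntegral_le_lintegral _ _).trans ?_
            rw [lintegral_sub_left_eq_self (truncPow ρ δ), lintegral_truncPow hρ.2 hδ0.le]
    rw [hu, tsub_le_iff_left]
    calc G x ≤ A + B * ((ENNReal.ofReal (δ ^ (1 - ρ) / (1 - ρ)) * (2 * A')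
          + ∫⁻ y in Ioc a R, truncPow ρ δ (x - y) * u y) + d * N) :=
          (hle x hx).trans (by gcongr; exact h1.trans (by gcongr))
      _ = A' + b * (2 * A') + B * ∫⁻ y in Ioc a R, truncPow ρ δ (x - y) * u y := by
          rw [hA', hb]; ring
      _ ≤ A' + 1 / 2 * (2 * A') + B * ∫⁻ y in Ioc a R, truncPow ρ δ (x - y) * u y := by gcongr
      _ = _ := by
          rw [show A' + 1 / 2 * (2 * A') = 2 * A' by
            rw [← mul_assoc, one_div, ENNReal.inv_mul_cancel (by simp) (by simp), one_mul,
              two_mul]]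
  have hu_int : ∫⁻ x in Ioc a R, u x ≠ ∞ :=
    ne_top_of_le_ne_top h_int (lintegral_mono fun x => tsub_le_self)
  have hcontr : ∫⁻ x in Ioc a R, u x ≤ 1 / 2 * ∫⁻ x in Ioc a R, u x := by
    calc _ ≤ ∫⁻ x in Ioc a R, B * ∫⁻ y in Ioc a R, truncPow ρ δ (x - y) * u y :=
          setLIntegral_mono' measurableSet_Ioc hu_le
      _ = B * ∫⁻ x in Ioc a R, ∫⁻ y in Ioc a R, truncPow ρ δ (x - y) * u y :=
          lintegral_const_mul' _ _ hB
      _ ≤ B * ∫⁻ x, ∫⁻ y in Ioc a R, truncPow ρ δ (x - y) * u y := by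
          gcongr
          exact Measure.restrict_le_self
      _ = B * ∫⁻ y in Ioc a R, ∫⁻ x, truncPow ρ δ (x - y) * u y := by
          rw [lintegral_lintegral_swap (f := fun x y => truncPow ρ δ (x - y) * u y)
            (by unfold Function.uncurry; fun_prop)]
      _ = b * ∫⁻ y in Ioc a R, u y := by
          rw [hb, mul_assoc, ← lintegral_const_mul _ hum]
          congr 1
          refine lintegral_congr fun y => ?_
          rw [lintegral_mul_const _ (by fun_prop), lintegral_sub_right_eq_self (truncPow ρ δ),
            lintegral_truncPow hρ.2 hδ0.le]
      _ ≤ _ := by gcongr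
  have hzero : ∫⁻ x in Ioc a R, u x = 0 := by
    by_contra h0
    refine absurd hcontr (not_le.2 ?_)
    rw [one_div, mul_comm, ← div_eq_mul_inv]
    exact ENNReal.half_lt_self h0 hu_int
  filter_upwards [(lintegral_eq_zero_iff hum).1 hzero] with x hx
  exact tsub_eq_zero_iff_le.1 hx

lemma continuousAt_lintegral_indicator {α : Type*} [MeasurableSpace α] {ν : Measure α}
    {f : α → ℝ≥0∞} {u v : α → ℝ} (hf : Measurable f) (hu : Measurable u) (hv : Measurable v)
    {x₀ R : ℝ} (hx₀ : x₀ < R) (h_int : ∫⁻ p in {p | u p ≤ R}, f p ∂ν ≠ ∞)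
    (hu0 : ν {p | u p = x₀} = 0) (hv0 : ν {p | v p = x₀} = 0) :
    ContinuousAt (fun x => ∫⁻ p, {p | u p ≤ x ∧ x ≤ v p}.indicator f p ∂ν) x₀ := by
  have hmeas (x : ℝ) : MeasurableSet {p | u p ≤ x ∧ x ≤ v p} := by
    rw [ofPred_and]
    exact (measurableSet_le hu measurable_const).inter (measurableSet_le measurable_const hv)
  have hS : MeasurableSet {p | u p ≤ R} := measurableSet_le hu measurable_const
  refine tendsto_lintegral_filter_of_dominated_convergence ({p | u p ≤ R}.indicator f)
    (Eventually.of_forall fun x => hf.indicator (hmeas x)) ?_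
    (by rwa [lintegral_indicator hS]) ?_
  · filter_upwards [Iio_mem_nhds hx₀] with x hx
    refine Eventually.of_forall fun p => ?_
    exact indicator_le_indicator_of_subset (fun p hp => hp.1.trans (le_of_lt hx))
      (fun _ => zero_le) p
  · have hu1 : ∀ᵐ p ∂ν, u p ≠ x₀ := by rw [ae_iff]; simpa using hu0
    have hv1 : ∀ᵐ p ∂ν, v p ≠ x₀ := by rw [ae_iff]; simpa using hv0
    filter_upwards [hu1, hv1] with p hup hvp
    refine tendsto_nhds_of_eventually_eq ?_
    have e1 : ∀ᶠ x in 𝓝 x₀, (u p ≤ x ↔ u p ≤ x₀) := by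
      rcases lt_or_gt_of_ne hup with h | h
      · filter_upwards [Ioi_mem_nhds h] with x hx
        exact iff_of_true (le_of_lt hx) h.le
      · filter_upwards [Iio_mem_nhds h] with x hx
        exact iff_of_false (not_le.2 hx) (not_le.2 h)
    have e2 : ∀ᶠ x in 𝓝 x₀, (x ≤ v p ↔ x₀ ≤ v p) := by
      rcases lt_or_gt_of_ne hvp with h | h
      · filter_upwards [Ioi_mem_nhds h] with x hx
        exact iff_of_false (not_le.2 hx) (not_le.2 h)
      · filter_upwards [Iio_mem_nhds h] with x hx
        exact iff_of_true (le_of_lt hx) h.le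
    filter_upwards [e1, e2] with x h1 h2
    simp only [indicator, mem_ofPred_eq, h1, h2]
    split_ifs <;> rfl

section Continuity

variable {K : ℝ → ℝ → ℝ} {γ C ρ : ℝ} {μ : Measure ℝ}

/-- The kernel `coagKer K` restricted to `z ≥ δ`. -/
def coagKerAbove (K : ℝ → ℝ → ℝ) (δ : ℝ) : ℝ × ℝ → ℝ≥0∞ :=
  {p : ℝ × ℝ | δ ≤ p.2}.indicator (coagKer K)

lemma KernelHyp.measurable_coagKerAbove (hK : KernelHyp K γ C) (δ : ℝ) :
    Measurable (coagKerAbove K δ) :=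
  hK.measurable_coagKer.indicator (measurableSet_le (by fun_prop) (by fun_prop))

lemma coagKerAbove_of_fst_nonpos {δ : ℝ} (p : ℝ × ℝ) (hp : p.1 ≤ 0) : coagKerAbove K δ p = 0 :=
  indicator_apply_eq_zero.2 fun _ => coagKer_of_fst_nonpos p hp

lemma coagKerAbove_le {δ : ℝ} (p : ℝ × ℝ) : coagKerAbove K δ p ≤ coagKer K p :=
  indicator_le_self _ _ p

lemma KernelHyp.lintegral_coagKerAbove_lt_top (hK : KernelHyp K γ C) (hγ : γ ∈ Ico (0 : ℝ) 1)
    (hC : 0 < C) (hρ : ρ ∈ Ioo γ 1) (hμ : PowerGrowth μ ρ) {R δ : ℝ} (hδ : δ ∈ Ioc 0 R) :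
    ∫⁻ p in {p | p.1 ≤ R}, coagKerAbove K δ p ∂μ.prod μ < ∞ := by
  have := hμ.isLocallyFiniteMeasure
  obtain ⟨c, -, hle⟩ := hK.lintegral_Ici_coagKer_le hγ hC hρ hμ (hδ.1.trans_le hδ.2)
  have hS : MeasurableSet {p : ℝ × ℝ | p.1 ≤ R} := measurableSet_le (by fun_prop) (by fun_prop)
  rw [← lintegral_indicator hS,
    lintegral_prod _ ((hK.measurable_coagKerAbove δ).indicator hS).aemeasurable]
  have hbound (y : ℝ) : ∫⁻ z, {p : ℝ × ℝ | p.1 ≤ R}.indicator (coagKerAbove K δ) (y, z) ∂μ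
      ≤ (Iic R).indicator (fun _ => ENNReal.ofReal c * truncPow ρ R δ) y := by
    by_cases hy : y ≤ R
    · rw [indicator_of_mem (show y ∈ Iic R from hy)]
      simp_rw [indicator_of_mem (show (y, _) ∈ {p : ℝ × ℝ | p.1 ≤ R} from hy)]
      by_cases hy0 : y ≤ 0
      · simp_rw [coagKerAbove_of_fst_nonpos (y, _) hy0]
        simp
      · refine le_trans (le_of_eq ?_) (hle y ⟨not_le.1 hy0, hy⟩ δ ⟨hδ.1.le, hδ.2⟩)
        rw [← lintegral_indicator measurableSet_Ici]
        rfl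
    · rw [indicator_of_notMem (show y ∉ Iic R from hy)]
      simp_rw [indicator_of_notMem (show (y, _) ∉ {p : ℝ × ℝ | p.1 ≤ R} from hy)]
      simp
  refine (lintegral_mono hbound).trans_lt ?_
  rw [lintegral_indicator measurableSet_Iic, setLIntegral_const]
  refine ENNReal.mul_lt_top (ENNReal.mul_lt_top ENNReal.ofReal_lt_top ?_) (hμ.Iic_lt_top R)
  rw [truncPow, indicator_of_mem (show δ ∈ Icc 0 R from ⟨hδ.1.le, hδ.2⟩),
    ENNReal.ofReal_rpow_of_pos hδ.1]
  exact ENNReal.ofReal_lt_top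

lemma KernelHyp.flux_coagKerAbove_ne_top (hK : KernelHyp K γ C) (hγ : γ ∈ Ico (0 : ℝ) 1)
    (hC : 0 < C) (hρ : ρ ∈ Ioo γ 1) (hμ : PowerGrowth μ ρ) {R δ x : ℝ} (hδ : δ ∈ Ioc 0 R)
    (hx : x ≤ R) : flux μ (coagKerAbove K δ) x ≠ ∞ := by
  have := hμ.isLocallyFiniteMeasure
  refine ne_top_of_le_ne_top (hK.lintegral_coagKerAbove_lt_top hγ hC hρ hμ hδ).ne ?_
  rw [flux_eq_lintegral_prod (hK.measurable_coagKerAbove δ) coagKerAbove_of_fst_nonpos,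
    ← lintegral_indicator (measurableSet_le (by fun_prop) (by fun_prop))]
  exact lintegral_mono fun p => indicator_le_indicator_of_subset
    (fun p hp => hp.1.trans hx) (fun _ => zero_le) p

lemma KernelHyp.continuousAt_flux_coagKerAbove (hK : KernelHyp K γ C)
    (hγ : γ ∈ Ico (0 : ℝ) 1) (hC : 0 < C) (hρ : ρ ∈ Ioo γ 1) (hμ : PowerGrowth μ ρ)
    (hatom : ∀ x, μ {x} = 0) {R δ x₀ : ℝ} (hδ : δ ∈ Ioc 0 R) (hx₀ : x₀ < R) :
    ContinuousAt (flux μ (coagKerAbove K δ)) x₀ := by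
  have := hμ.isLocallyFiniteMeasure
  have h := continuousAt_lintegral_indicator (ν := μ.prod μ) (hK.measurable_coagKerAbove δ)
    measurable_fst (measurable_fst.add measurable_snd) hx₀
    (hK.lintegral_coagKerAbove_lt_top hγ hC hρ hμ hδ).ne ?_ ?_
  · convert h using 1
    funext x
    exact flux_eq_lintegral_prod (hK.measurable_coagKerAbove δ) coagKerAbove_of_fst_nonpos x
  · rw [show {p : ℝ × ℝ | p.1 = x₀} = {x₀} ×ˢ univ by ext; simp, Measure.prod_prod, hatom,
      zero_mul]
  · rw [Measure.measure_prod_null (measurableSet_eq_fun (by fun_prop) (by fun_prop))]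
    refine Eventually.of_forall fun y => ?_
    refine measure_mono_null (fun z hz => ?_) (hatom (x₀ - y))
    have : y + z = x₀ := hz
    exact mem_singleton_iff.2 (by linarith)

lemma KernelHyp.flux_coagKer_ne_top_and_continuousAt (hK : KernelHyp K γ C)
    (hγ : γ ∈ Ico (0 : ℝ) 1) (hC : 0 < C) (hρ : ρ ∈ Ioo γ 1) (hμ : PowerGrowth μ ρ)
    (hatom : ∀ x, μ {x} = 0) {a R x₀ : ℝ} {M : ℝ≥0∞} (ha : 0 ≤ a) (hx₀ : x₀ ∈ Ioo a R)
    (hM : M ≠ ∞) (hMμ : μ.restrict (Ioc a R) ≤ M • volume) :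
    flux μ (coagKer K) x₀ ≠ ∞ ∧ ContinuousAt (flux μ (coagKer K)) x₀ := by
  have := hμ.isLocallyFiniteMeasure
  have hR : 0 < R := ha.trans_lt (hx₀.1.trans hx₀.2)
  obtain ⟨c, -, hle⟩ := hK.lintegral_Ici_coagKer_le hγ hC hρ hμ hR
  have hnear (δ : ℝ) (hδ : 0 < δ) (x : ℝ) (hxa : a + δ < x) (hxR : x ≤ R) :
      flux μ (coagKer K) x ≤ flux μ (coagKerAbove K δ) x
        + ENNReal.ofReal c * (M * ENNReal.ofReal (δ ^ (1 - ρ) / (1 - ρ))) := by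
    have hpt (y : ℝ) (hy : y ∈ Ioc 0 x) : ∫⁻ z in Ici (x - y), coagKer K (y, z) ∂μ
        ≤ (∫⁻ z in Ici (x - y), coagKerAbove K δ (y, z) ∂μ)
          + ENNReal.ofReal c * truncPow ρ δ (x - y) := by
      rcases le_total (x - y) δ with h | h
      · refine le_add_of_le_right ((hle y ⟨hy.1, hy.2.trans hxR⟩ (x - y)
          ⟨by linarith [hy.2], by linarith [hy.1]⟩).trans (le_of_eq ?_))
        rw [truncPow, truncPow,
          indicator_of_mem (show x - y ∈ Icc 0 δ from ⟨by linarith [hy.2], h⟩),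
          indicator_of_mem (show x - y ∈ Icc 0 R from ⟨by linarith [hy.2], by linarith [hy.1]⟩)]
      · refine le_add_of_le_left (le_of_eq ?_)
        refine setLIntegral_congr_fun measurableSet_Ici fun z hz => ?_
        exact (indicator_of_mem (show (y, z) ∈ {p : ℝ × ℝ | δ ≤ p.2} from h.trans hz) _).symm
    have hsmall : ∫⁻ y in Ioc 0 x, truncPow ρ δ (x - y) ∂μ
        ≤ M * ENNReal.ofReal (δ ^ (1 - ρ) / (1 - ρ)) := by
      calc ∫⁻ y in Ioc 0 x, truncPow ρ δ (x - y) ∂μ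
          ≤ ∫⁻ y in Ioc a R, truncPow ρ δ (x - y) ∂μ := by
            rw [← lintegral_indicator measurableSet_Ioc, ← lintegral_indicator measurableSet_Ioc]
            refine lintegral_mono fun y => ?_
            by_cases hy : y ∈ Ioc a R
            · rw [indicator_of_mem hy]
              exact indicator_le_self _ _ y
            · refine le_of_eq_of_le (indicator_apply_eq_zero.2 fun hy' => ?_) zero_le
              refine indicator_of_notMem (fun h => hy ⟨?_, hy'.2.trans hxR⟩) _
              linarith [h.2]
        _ ≤ ∫⁻ y, truncPow ρ δ (x - y) ∂(M • volume) := lintegral_mono' hMμ le_rfl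
        _ = _ := by
            rw [lintegral_smul_measure, lintegral_sub_left_eq_self (truncPow ρ δ),
              lintegral_truncPow hρ.2 hδ.le, smul_eq_mul]
    calc flux μ (coagKer K) x
        ≤ ∫⁻ y in Ioc 0 x, ((∫⁻ z in Ici (x - y), coagKerAbove K δ (y, z) ∂μ)
          + ENNReal.ofReal c * truncPow ρ δ (x - y)) ∂μ :=
          setLIntegral_mono' measurableSet_Ioc hpt
      _ = flux μ (coagKerAbove K δ) x
          + ENNReal.ofReal c * ∫⁻ y in Ioc 0 x, truncPow ρ δ (x - y) ∂μ := by
          rw [lintegral_add_left (measurable_lintegral_Ici_sub (hK.measurable_coagKerAbove δ) x),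
            lintegral_const_mul _ (by fun_prop)]
          rfl
      _ ≤ _ := by gcongr
  have habove (δ x : ℝ) : flux μ (coagKerAbove K δ) x ≤ flux μ (coagKer K) x :=
    lintegral_mono fun y => lintegral_mono fun z => coagKerAbove_le _
  have hchoose (ε : ℝ≥0∞) (hε : 0 < ε) : ∃ δ ∈ Ioc 0 R, a + δ < x₀ ∧
      ENNReal.ofReal c * (M * ENNReal.ofReal (δ ^ (1 - ρ) / (1 - ρ))) < ε := by
    have h := ENNReal.Tendsto.const_mul (a := ENNReal.ofReal c)
      (ENNReal.Tendsto.const_mul (a := M) (tendsto_rpow_div_nhdsGT_zero hρ.2) (Or.inr hM))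
      (Or.inr ENNReal.ofReal_ne_top)
    rw [mul_zero, mul_zero] at h
    obtain ⟨δ, h1, h2, h3⟩ := ((h.eventually_lt_const hε).and
      (Ioc_mem_nhdsGT (lt_min hR (half_pos (sub_pos.2 hx₀.1))))).exists
    refine ⟨δ, ⟨h2, h3.trans (min_le_left _ _)⟩, ?_, h1⟩
    have := h3.trans (min_le_right _ _)
    linarith [hx₀.1]
  have hfin : flux μ (coagKer K) x₀ ≠ ∞ := by
    obtain ⟨δ, hδ, hδx, hδ1⟩ := hchoose 1 one_pos
    refine ne_top_of_le_ne_top (ENNReal.add_ne_top.2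
      ⟨hK.flux_coagKerAbove_ne_top hγ hC hρ hμ hδ hx₀.2.le, hδ1.ne_top⟩)
      (hnear δ hδ.1 x₀ hδx hx₀.2.le)
  refine ⟨hfin, (ENNReal.tendsto_nhds hfin).2 fun ε hε => ?_⟩
  obtain ⟨δ, hδ, hδx, hδε⟩ := hchoose (ε / 2) (ENNReal.half_pos hε.ne')
  have hcont := (ENNReal.tendsto_nhds (hK.flux_coagKerAbove_ne_top hγ hC hρ hμ hδ hx₀.2.le)).1
    (hK.continuousAt_flux_coagKerAbove hγ hC hρ hμ hatom hδ hx₀.2) (ε / 2)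
    (ENNReal.half_pos hε.ne')
  filter_upwards [hcont, Ioo_mem_nhds hδx hx₀.2] with x hx hxI
  have hx1 := (hnear δ hδ.1 x hxI.1 hxI.2.le).trans (add_le_add_right hδε.le _)
  have hx2 := (hnear δ hδ.1 x₀ hδx hx₀.2.le).trans (add_le_add_right hδε.le _)
  constructor
  · rw [tsub_le_iff_right]
    calc _ ≤ flux μ (coagKerAbove K δ) x + ε / 2 + ε / 2 :=
          hx2.trans (add_le_add_left (tsub_le_iff_right.1 hx.1) _)
      _ ≤ _ := by
          rw [add_assoc, ENNReal.add_halves]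
          gcongr
          exact habove δ x
  · calc _ ≤ flux μ (coagKerAbove K δ) x₀ + ε / 2 + ε / 2 :=
          hx1.trans (add_le_add_left hx.2 _)
      _ ≤ _ := by
          rw [add_assoc, ENNReal.add_halves]
          gcongr
          exact habove δ x₀

end Continuity

/-- A continuous compactly supported function on `[0, ∞)` is the restriction of the derivative of
a compactly supported `C¹` function on `ℝ`. -/
lemma exists_contDiff_hasCompactSupport_deriv_eq {φ : ℝ → ℝ} (hφ : Continuous φ)
    (hφs : HasCompactSupport φ) :
    ∃ ψ : ℝ → ℝ, ContDiff ℝ 1 ψ ∧ HasCompactSupport ψ ∧ HasCompactSupport (deriv ψ) ∧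
      (∀ x > 0, deriv ψ x = φ x) ∧ ∀ y, ψ y = -∫ x in Ioi y, deriv ψ x := by
  let b : ContDiffBump (-2 : ℝ) := ⟨1 / 2, 1, by norm_num, by norm_num⟩
  set f : ℝ → ℝ := fun x => φ x - (∫ t, φ t) * b.normed volume x with hf
  have hbc : Continuous (b.normed volume) := b.continuous_normed
  have hbs : HasCompactSupport (b.normed volume) := b.hasCompactSupport_normed
  have hfc : Continuous f := by fun_prop
  have hfs : HasCompactSupport f := hφs.sub hbs.mul_left
  have hfi : Integrable f := hfc.integrable_of_hasCompactSupport hfs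
  have hf0 : ∫ x, f x = 0 := by
    rw [hf, integral_sub (hφ.integrable_of_hasCompactSupport hφs)
      ((hbc.integrable_of_hasCompactSupport hbs).const_mul _), integral_const_mul,
      b.integral_normed, mul_one, sub_self]
  set ψ : ℝ → ℝ := fun y => ∫ x in Iic y, f x with hψ
  have hψ' (y : ℝ) : ψ y = -∫ x in Ioi y, f x := by
    have := intervalIntegral.integral_Iic_add_Ioi (b := y) hfi.integrableOn hfi.integrableOn
    rw [hf0] at this
    exact eq_neg_of_add_eq_zero_left this
  have hderiv (y : ℝ) : HasDerivAt ψ (f y) y := by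
    have h : ψ = fun y => (∫ x in Iic 0, f x) + ∫ x in (0 : ℝ)..y, f x := by
      funext y
      rw [← intervalIntegral.integral_Iic_sub_Iic hfi.integrableOn hfi.integrableOn]
      simp [hψ]
    rw [h]
    exact (hfc.integral_hasStrictDerivAt 0 y).hasDerivAt.const_add _
  have hd : deriv ψ = f := funext fun y => (hderiv y).deriv
  refine ⟨ψ, contDiff_one_iff_deriv.2 ⟨fun y => (hderiv y).differentiableAt, hd ▸ hfc⟩, ?_,
    hd ▸ hfs, fun x hx => ?_, fun y => by rw [hd, hψ']⟩
  · obtain ⟨N, hN⟩ := hfs.isBounded.subset_closedBall 0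
    have hz (x : ℝ) (hx : x ∉ Icc (-N) N) : f x = 0 := by
      by_contra h
      have := hN (subset_tsupport _ (Function.mem_support.2 h))
      rw [mem_closedBall_zero_iff, Real.norm_eq_abs, abs_le] at this
      exact hx this
    refine HasCompactSupport.intro (isCompact_Icc (a := -N) (b := N)) fun y hy => ?_
    by_cases h : y < -N
    · exact setIntegral_eq_zero_of_forall_eq_zero fun x hx =>
        hz x fun hx' => (h.trans_le hx'.1).not_ge hx
    · rw [hψ', setIntegral_eq_zero_of_forall_eq_zero, neg_zero]
      exact fun x hx => hz x fun hx' => hy ⟨not_lt.1 h, (le_of_lt hx).trans hx'.2⟩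
  · have : b.normed volume x = 0 := by
      rw [← Function.notMem_support, b.support_normed_eq, Metric.mem_ball, Real.dist_eq, not_lt]
      exact le_abs.2 (Or.inl (by change 1 ≤ x - -2; linarith))
    rw [hd, hf]
    simp only [this, mul_zero, sub_zero]

lemma locallyIntegrable_toReal_of_lintegral_Ioc_lt_top {f : ℝ → ℝ≥0∞} (hf : Measurable f)
    (hfin : ∀ R > 0, ∫⁻ x in Ioc 0 R, f x < ∞) :
    LocallyIntegrable (fun x => (f x).toReal) (volume.restrict (Ioi 0)) := by
  intro x
  refine ⟨Iic (|x| + 1), Iic_mem_nhds (by linarith [le_abs_self x]), ?_⟩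
  rw [IntegrableOn, Measure.restrict_restrict measurableSet_Iic, inter_comm, Ioi_inter_Iic]
  exact integrable_toReal_of_lintegral_ne_top hf.aemeasurable (hfin _ (by positivity)).ne

lemma isLocallyFiniteMeasure_withDensity_of_lintegral_Ioc_lt_top {f : ℝ → ℝ≥0∞}
    (hfin : ∀ R > 0, ∫⁻ x in Ioc 0 R, f x < ∞) :
    IsLocallyFiniteMeasure ((volume.restrict (Ioi 0)).withDensity f) := by
  refine ⟨fun x => ⟨Iic (|x| + 1), Iic_mem_nhds (by linarith [le_abs_self x]), ?_⟩⟩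
  rw [withDensity_apply _ measurableSet_Iic, Measure.restrict_restrict measurableSet_Iic,
    inter_comm, Ioi_inter_Iic]
  exact hfin _ (by positivity)

lemma ae_lt_top_of_lintegral_Ioc_lt_top {f : ℝ → ℝ≥0∞} (hf : Measurable f)
    (hfin : ∀ R > 0, ∫⁻ x in Ioc 0 R, f x < ∞) :
    ∀ᵐ x ∂volume.restrict (Ioi 0), f x < ∞ := by
  have hU : ⋃ n : ℕ, Ioc (0 : ℝ) (n + 1) = Ioi 0 :=
    iUnion_Ioc_eq_Ioi_self_iff.2 fun x _ =>
      (exists_nat_ge x).imp fun n hn => hn.trans (by linarith)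
  rw [← hU, ae_restrict_iUnion_iff]
  exact fun n => ae_lt_top hf (hfin _ (by positivity)).ne

lemma PowerGrowth.integral_eq_neg_integral_mul_cdf {μ : Measure ℝ} {ρ : ℝ}
    (hμ : PowerGrowth μ ρ) {f ψ : ℝ → ℝ} (hf : Continuous f) (hfs : HasCompactSupport f)
    (hψ : ∀ y, ψ y = -∫ x in Ioi y, f x) :
    ∫ y, ψ y ∂μ = -∫ x in Ioi 0, f x * μ.real (Iio x) := by
  obtain ⟨N, hN⟩ := hfs.isBounded.subset_closedBall 0
  have hz (x : ℝ) (hx : N < x) : f x = 0 := by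
    by_contra h
    have := hN (subset_tsupport _ (Function.mem_support.2 h))
    rw [mem_closedBall_zero_iff, Real.norm_eq_abs, abs_le] at this
    exact this.2.not_gt hx
  have : IsFiniteMeasure (μ.restrict (Iic N)) :=
    ⟨by rw [Measure.restrict_apply_univ]; exact hμ.Iic_lt_top N⟩
  have hS : MeasurableSet {p : ℝ × ℝ | p.1 < p.2} := measurableSet_lt measurable_fst measurable_snd
  have h_int : Integrable ({p : ℝ × ℝ | p.1 < p.2}.indicator fun p => f p.2)
      ((μ.restrict (Iic N)).prod volume) :=
    ((hf.integrable_of_hasCompactSupport hfs).comp_snd _).indicator hS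
  calc ∫ y, ψ y ∂μ = ∫ y in Iic N, ψ y ∂μ := by
        refine (setIntegral_eq_integral_of_forall_compl_eq_zero fun y hy => ?_).symm
        rw [hψ, setIntegral_eq_zero_of_forall_eq_zero, neg_zero]
        exact fun x hx => hz x ((not_le.1 hy).trans hx)
    _ = -∫ y in Iic N, (∫ x, {p : ℝ × ℝ | p.1 < p.2}.indicator (fun p => f p.2) (y, x)) ∂μ := by
        rw [← integral_neg]
        congr 1
        funext y
        rw [hψ, ← integral_indicator measurableSet_Ioi]
        rfl
    _ = -∫ x, ∫ y in Iic N, {p : ℝ × ℝ | p.1 < p.2}.indicator (fun p => f p.2) (y, x) ∂μ := by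
        rw [integral_integral_swap (f := fun y x =>
          {p : ℝ × ℝ | p.1 < p.2}.indicator (fun p => f p.2) (y, x)) h_int]
    _ = -∫ x, f x * μ.real (Iio x) := by
        congr 2
        funext x
        have h : (fun y => {p : ℝ × ℝ | p.1 < p.2}.indicator (fun p => f p.2) (y, x))
          = (Iio x).indicator fun _ => f x := rfl
        rw [h, integral_indicator_const _ measurableSet_Iio, smul_eq_mul, mul_comm]
        rcases lt_or_ge N x with hx | hx
        · rw [hz x hx, zero_mul, zero_mul]
        · rw [measureReal_restrict_apply measurableSet_Iio,
            inter_eq_left.2 (show Iio x ⊆ Iic N from fun y hy => (le_of_lt hy).trans hx)]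
    _ = _ := by
        congr 1
        refine (setIntegral_eq_integral_of_forall_compl_eq_zero fun x hx => ?_).symm
        have : μ (Iio x) = 0 := measure_mono_null (Iio_subset_Iio (not_lt.1 hx)) hμ.supp
        rw [measureReal_def, this, ENNReal.toReal_zero, mul_zero]

lemma truncPow_anti {ρ r s t : ℝ} (hρ : 0 ≤ ρ) (hs : 0 ≤ s) (hst : s ≤ t) :
    truncPow ρ r t ≤ truncPow ρ r s := by
  by_cases ht : t ∈ Icc 0 r
  · have hs' : s ∈ Icc 0 r := ⟨hs, hst.trans ht.2⟩
    rw [truncPow, truncPow, indicator_of_mem ht, indicator_of_mem hs', ENNReal.rpow_neg,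
      ENNReal.rpow_neg]
    gcongr
  · rw [truncPow, indicator_of_notMem ht]
    exact zero_le

section Density

variable {K : ℝ → ℝ → ℝ} {γ C ρ : ℝ} {μ : Measure ℝ}

/-- The density of `β x dμ(x)` for a weak stationary solution `μ`, where `b = β (1 - ρ)`. -/
def momentDensity (K : ℝ → ℝ → ℝ) (b : ℝ) (μ : Measure ℝ) (x : ℝ) : ℝ≥0∞ :=
  flux μ (coagKer K) x + ENNReal.ofReal b * μ (Iio x)

lemma measurable_measure_Iio (μ : Measure ℝ) : Measurable fun x => μ (Iio x) :=
  Monotone.measurable fun _ _ h => measure_mono (Iio_subset_Iio h)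

lemma KernelHyp.measurable_momentDensity (hK : KernelHyp K γ C) [SFinite μ] (b : ℝ) :
    Measurable (momentDensity K b μ) :=
  (measurable_flux hK.measurable_coagKer coagKer_of_fst_nonpos).add
    ((measurable_measure_Iio μ).const_mul _)

lemma PowerGrowth.lintegral_measure_Iio_lt_top (hμ : PowerGrowth μ ρ) (R : ℝ) :
    ∫⁻ x in Ioc 0 R, μ (Iio x) < ∞ := by
  refine (setLIntegral_mono measurable_const fun x (hx : x ∈ Ioc 0 R) =>
    measure_mono (Iio_subset_Iic hx.2)).trans_lt ?_
  rw [setLIntegral_const]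
  exact ENNReal.mul_lt_top (hμ.Iic_lt_top R) measure_Ioc_lt_top

lemma KernelHyp.lintegral_momentDensity_lt_top (hK : KernelHyp K γ C)
    (hγ : γ ∈ Ico (0 : ℝ) 1) (hC : 0 < C) (hρ : ρ ∈ Ioo γ 1) (hμ : PowerGrowth μ ρ) (b : ℝ)
    {R : ℝ} (hR : 0 < R) : ∫⁻ x in Ioc 0 R, momentDensity K b μ x < ∞ := by
  have := hμ.isLocallyFiniteMeasure
  simp only [momentDensity]
  rw [lintegral_add_right _ ((measurable_measure_Iio μ).const_mul _),
    lintegral_const_mul _ (measurable_measure_Iio μ)]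
  exact ENNReal.add_lt_top.2 ⟨hK.lintegral_flux_lt_top hγ hC hρ hμ hR,
    ENNReal.mul_lt_top ENNReal.ofReal_lt_top (hμ.lintegral_measure_Iio_lt_top R)⟩

lemma KernelHyp.withDensity_mul_eq (hK : KernelHyp K γ C) (hγ : γ ∈ Ico (0 : ℝ) 1)
    (hC : 0 < C) (hρ : ρ ∈ Ioo γ 1) (hμ : PowerGrowth μ ρ) {β : ℝ} (hβ : 0 < β)
    (hweak : ∀ ψ : ℝ → ℝ, ContDiff ℝ 1 ψ → HasCompactSupport ψ →
      (∫ x in Ioi (0 : ℝ), deriv ψ x * Imeas K μ x)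
        - β * (∫ x, deriv (fun w => w * ψ w) x ∂μ) + β * ρ * (∫ x, ψ x ∂μ) = 0) :
    μ.withDensity (fun x => ENNReal.ofReal (β * x))
      = (volume.restrict (Ioi 0)).withDensity (momentDensity K (β * (1 - ρ)) μ) := by
  have := hμ.isLocallyFiniteMeasure
  have hb : 0 ≤ β * (1 - ρ) := mul_nonneg hβ.le (by linarith [hρ.2])
  have hflux : Measurable (flux μ (coagKer K)) :=
    measurable_flux hK.measurable_coagKer coagKer_of_fst_nonpos
  have hfluxlt (R : ℝ) (hR : 0 < R) := hK.lintegral_flux_lt_top hγ hC hρ hμ hR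
  have hD := hK.measurable_momentDensity (μ := μ) (β * (1 - ρ))
  have hDlt (R : ℝ) (hR : 0 < R) :=
    hK.lintegral_momentDensity_lt_top hγ hC hρ hμ (β * (1 - ρ)) hR
  have : IsLocallyFiniteMeasure (μ.withDensity fun x => ENNReal.ofReal (β * x)) :=
    IsLocallyFiniteMeasure.withDensity_ofReal (by fun_prop)
  have := isLocallyFiniteMeasure_withDensity_of_lintegral_Ioc_lt_top hDlt
  have hfin := ae_lt_top_of_lintegral_Ioc_lt_top hflux hfluxlt
  refine Measure.ext_of_integral_eq_on_compactlySupported fun φ => ?_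
  obtain ⟨ψ, hψ, hψs, hψ's, hφ, hψφ⟩ :=
    exists_contDiff_hasCompactSupport_deriv_eq φ.1.continuous φ.2
  have hψ' : Continuous (deriv ψ) := hψ.continuous_deriv le_rfl
  have hw := hweak ψ hψ hψs
  have hIψ : Integrable ψ μ := hψ.continuous.integrable_of_hasCompactSupport hψs
  have hIψ' : Integrable (fun x => x * deriv ψ x) μ :=
    (continuous_id.mul hψ').integrable_of_hasCompactSupport hψ's.mul_left
  have hderiv (x : ℝ) : deriv (fun w => w * ψ w) x = ψ x + x * deriv ψ x := by
    have hd : DifferentiableAt ℝ ψ x := (hψ.differentiable one_ne_zero).differentiableAt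
    have := ((hasDerivAt_id x).mul hd.hasDerivAt).deriv
    simpa [Pi.mul_def] using this
  simp_rw [hderiv] at hw
  rw [integral_add hIψ hIψ', hμ.integral_eq_neg_integral_mul_cdf hψ' hψ's hψφ,
    setIntegral_congr_ae (g := fun x => deriv ψ x * (flux μ (coagKer K) x).toReal)
      measurableSet_Ioi] at hw
  swap
  · rw [← ae_restrict_iff' measurableSet_Ioi]
    filter_upwards [hfin] with x hx
    rw [hK.Imeas_eq_toReal_flux hρ.2 hμ hx.ne]
  have hI₁ : IntegrableOn (fun x => deriv ψ x * (flux μ (coagKer K) x).toReal) (Ioi 0) :=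
    (locallyIntegrable_toReal_of_lintegral_Ioc_lt_top hflux
      hfluxlt).integrable_smul_left_of_hasCompactSupport hψ' hψ's
  have hI₂ : IntegrableOn (fun x => deriv ψ x * μ.real (Iio x)) (Ioi 0) :=
    (locallyIntegrable_toReal_of_lintegral_Ioc_lt_top (measurable_measure_Iio μ)
      fun R _ => hμ.lintegral_measure_Iio_lt_top R).integrable_smul_left_of_hasCompactSupport
        hψ' hψ's
  rw [integral_withDensity_eq_integral_toReal_smul (by fun_prop)
      (ae_of_all _ fun _ => ENNReal.ofReal_lt_top),
    integral_withDensity_eq_integral_toReal_smul hD (ae_lt_top_of_lintegral_Ioc_lt_top hD hDlt)]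
  have h₁ : ∫ x, (ENNReal.ofReal (β * x)).toReal • φ x ∂μ = β * ∫ x, x * deriv ψ x ∂μ := by
    rw [← integral_const_mul]
    refine integral_congr_ae ?_
    filter_upwards [hμ.ae_pos hρ.2] with x hx
    rw [ENNReal.toReal_ofReal (by positivity), hφ x hx, smul_eq_mul, mul_assoc]
    rfl
  have h₂ : ∫ x in Ioi 0, (momentDensity K (β * (1 - ρ)) μ x).toReal • φ x
      = (∫ x in Ioi 0, deriv ψ x * (flux μ (coagKer K) x).toReal)
        + β * (1 - ρ) * ∫ x in Ioi 0, deriv ψ x * μ.real (Iio x) := by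
    rw [← integral_const_mul, ← integral_add hI₁ (hI₂.const_mul _)]
    refine integral_congr_ae ?_
    filter_upwards [hfin, ae_restrict_mem measurableSet_Ioi] with x hx hx0
    have hx' : μ (Iio x) ≠ ∞ :=
      ((measure_mono Iio_subset_Iic_self).trans_lt (hμ.Iic_lt_top x)).ne
    rw [momentDensity, ENNReal.toReal_add hx.ne (ENNReal.mul_ne_top ENNReal.ofReal_ne_top hx'),
      ENNReal.toReal_mul, ENNReal.toReal_ofReal hb, hφ x hx0, smul_eq_mul, measureReal_def]
    change _ * φ x = φ x * _ + _ * (φ x * _)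
    ring
  rw [h₁, h₂]
  linarith

/-- The density of a weak stationary solution. -/
def profileDensity (K : ℝ → ℝ → ℝ) (β ρ : ℝ) (μ : Measure ℝ) (x : ℝ) : ℝ≥0∞ :=
  momentDensity K (β * (1 - ρ)) μ x * (ENNReal.ofReal (β * x))⁻¹

lemma KernelHyp.measurable_profileDensity (hK : KernelHyp K γ C) [SFinite μ] (β ρ : ℝ) :
    Measurable (profileDensity K β ρ μ) :=
  (hK.measurable_momentDensity _).mul (by fun_prop)

lemma KernelHyp.eq_withDensity_profileDensity (hK : KernelHyp K γ C) (hρ : ρ < 1)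
    (hμ : PowerGrowth μ ρ) {β : ℝ} (hβ : 0 < β)
    (h : μ.withDensity (fun x => ENNReal.ofReal (β * x))
      = (volume.restrict (Ioi 0)).withDensity (momentDensity K (β * (1 - ρ)) μ)) :
    μ = (volume.restrict (Ioi 0)).withDensity (profileDensity K β ρ μ) := by
  have := hμ.isLocallyFiniteMeasure
  have hm : Measurable fun x => ENNReal.ofReal (β * x) := by fun_prop
  calc μ = (μ.withDensity fun x => ENNReal.ofReal (β * x)).withDensity
        fun x => (ENNReal.ofReal (β * x))⁻¹ := by
        refine (withDensity_inv_same hm ?_ (ae_of_all _ fun _ => ENNReal.ofReal_ne_top)).symm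
        filter_upwards [hμ.ae_pos hρ] with x hx
        exact (ENNReal.ofReal_pos.2 (mul_pos hβ hx)).ne'
    _ = _ := by
        rw [h]
        exact (withDensity_mul _ (hK.measurable_momentDensity _) hm.inv).symm

lemma KernelHyp.exists_restrict_Ioc_le (hK : KernelHyp K γ C) (hγ : γ ∈ Ico (0 : ℝ) 1)
    (hC : 0 < C) (hρ : ρ ∈ Ioo γ 1) (hμ : PowerGrowth μ ρ) {β : ℝ} (hβ : 0 < β)
    {G : ℝ → ℝ≥0∞} (hGm : Measurable G) (hG : G = profileDensity K β ρ μ)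
    (hμG : μ = (volume.restrict (Ioi 0)).withDensity G) {x₀ R : ℝ} (hx₀ : x₀ ∈ Ioo 0 R) :
    ∃ a ∈ Ioo 0 x₀, ∃ M : ℝ≥0∞, M ≠ ∞ ∧ μ.restrict (Ioc a R) ≤ M • volume := by
  have := hμ.isLocallyFiniteMeasure
  have hR : 0 < R := hx₀.1.trans hx₀.2
  have hρ0 : 0 ≤ ρ := hγ.1.trans hρ.1.le
  obtain ⟨c, -, hle⟩ := hK.lintegral_Ici_coagKer_le hγ hC hρ hμ hR
  set Q : ℝ → ℝ≥0∞ := fun x => ∫⁻ y in Iic R, truncPow ρ R (x - y) ∂μ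
  have hQm : Measurable Q :=
    Measurable.lintegral_prod_right' (f := fun p : ℝ × ℝ => truncPow ρ R (p.1 - p.2))
      (by fun_prop)
  obtain ⟨a, ha, hQa⟩ : ∃ a ∈ Ioo 0 x₀, Q a < ∞ := by
    have hne : NeBot (ae (volume.restrict (Ioo 0 x₀))) := by
      rw [ae_neBot, Ne, Measure.restrict_eq_zero, Real.volume_Ioo]
      simpa using hx₀.1
    exact ((ae_restrict_mem measurableSet_Ioo).and (ae_restrict_of_ae
      (ae_lt_top hQm (hμ.lintegral_potential_lt_top hρ.2 hR).ne))).exists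
  have hμIoc {s : Set ℝ} (hs : MeasurableSet s) (hsub : s ⊆ Ioi 0) :
      μ.restrict s = (volume.restrict s).withDensity G := by
    rw [hμG, restrict_withDensity hs, Measure.restrict_restrict hs, inter_eq_left.2 hsub]
  have hsub (x : ℝ) : Ioc a x ⊆ Ioi 0 := fun y hy => ha.1.trans hy.1
  refine ⟨a, ha, ?_⟩
  set d := (ENNReal.ofReal (β * a))⁻¹
  have hdt : d ≠ ∞ := ENNReal.inv_ne_top.2 (ENNReal.ofReal_pos.2 (mul_pos hβ ha.1)).ne'
  have hbound (x : ℝ) (hx : x ∈ Ioc a R) :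
      G x ≤ (ENNReal.ofReal c * Q a + ENNReal.ofReal (β * (1 - ρ)) * μ (Iic R)) * d
        + ENNReal.ofReal c * d * ∫⁻ y in Ioc a x, truncPow ρ R (x - y) * G y := by
    have h₁ : ∫⁻ y in Ioc 0 a, truncPow ρ R (x - y) ∂μ ≤ Q a := by
      refine (setLIntegral_mono (by fun_prop) fun y hy => ?_).trans
        (lintegral_mono_set (fun y hy => hy.2.trans (hx.1.le.trans hx.2)))
      exact truncPow_anti hρ0 (sub_nonneg.2 hy.2) (sub_le_sub_right hx.1.le y)
    have h₂ : ∫⁻ y in Ioc a x, truncPow ρ R (x - y) ∂μ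
        = ∫⁻ y in Ioc a x, truncPow ρ R (x - y) * G y := by
      rw [hμIoc measurableSet_Ioc (hsub x),
        lintegral_withDensity_eq_lintegral_mul _ hGm (by fun_prop)]
      simp only [Pi.mul_apply, mul_comm]
    have h₃ : flux μ (coagKer K) x ≤ ENNReal.ofReal c *
        (Q a + ∫⁻ y in Ioc a x, truncPow ρ R (x - y) * G y) := by
      refine (flux_coagKer_le hle hx.2).trans ?_
      gcongr
      rw [← Ioc_union_Ioc_eq_Ioc ha.1.le hx.1.le]
      exact (lintegral_union_le _ _ _).trans (add_le_add h₁ h₂.le)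
    calc G x ≤ (ENNReal.ofReal c * (Q a + ∫⁻ y in Ioc a x, truncPow ρ R (x - y) * G y)
          + ENNReal.ofReal (β * (1 - ρ)) * μ (Iic R)) * d := by
          rw [hG, profileDensity, momentDensity, ← hG]
          gcongr
          · exact fun y hy => (le_of_lt hy).trans hx.2
          · exact ENNReal.inv_le_inv.2 (ENNReal.ofReal_le_ofReal (by gcongr; exact hx.1.le))
      _ = _ := by ring
  obtain ⟨M, hM, hGM⟩ := ae_le_of_le_volterra hGm ⟨hρ0, hρ.2⟩
    (ENNReal.mul_ne_top (ENNReal.add_ne_top.2 ⟨ENNReal.mul_ne_top ENNReal.ofReal_ne_top hQa.ne,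
      ENNReal.mul_ne_top ENNReal.ofReal_ne_top (hμ.Iic_lt_top R).ne⟩) hdt)
    (ENNReal.mul_ne_top ENNReal.ofReal_ne_top hdt) (by
      rw [← setLIntegral_univ, ← withDensity_apply _ .univ, ← hμIoc measurableSet_Ioc (hsub R),
        Measure.restrict_apply_univ]
      exact ((measure_mono Ioc_subset_Iic_self).trans_lt (hμ.Iic_lt_top R)).ne) hbound
  refine ⟨M, hM, ?_⟩
  rw [hμIoc measurableSet_Ioc (hsub R)]
  refine (withDensity_mono hGM).trans ?_
  rw [withDensity_const]
  exact Measure.le_iff'.2 fun s => mul_le_mul_right (Measure.restrict_le_self s) M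

lemma PowerGrowth.continuousAt_measure_Iio (hμ : PowerGrowth μ ρ) (hatom : ∀ x, μ {x} = 0)
    (x₀ : ℝ) : ContinuousAt (fun x => μ (Iio x)) x₀ := by
  have h := continuousAt_lintegral_indicator (ν := μ) (f := 1) (u := id) (v := fun _ => x₀ + 1)
    measurable_one measurable_id measurable_const (lt_add_one x₀)
    (by simp only [Pi.one_apply, setLIntegral_one]; exact (hμ.Iic_lt_top (x₀ + 1)).ne)
    (by simpa using hatom x₀) (by simp)
  refine h.congr ?_
  filter_upwards [Iic_mem_nhds (lt_add_one x₀)] with x hx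
  have : {p : ℝ | id p ≤ x ∧ x ≤ x₀ + 1} = Iic x := by ext; simpa using fun _ => hx
  rw [this, lintegral_indicator_one measurableSet_Iic,
    measure_congr (Iio_ae_eq_Iic' (hatom x))]

lemma KernelHyp.momentDensity_ne_top_and_continuousAt (hK : KernelHyp K γ C)
    (hγ : γ ∈ Ico (0 : ℝ) 1) (hC : 0 < C) (hρ : ρ ∈ Ioo γ 1) (hμ : PowerGrowth μ ρ) {β : ℝ}
    (hβ : 0 < β) (h : μ = (volume.restrict (Ioi 0)).withDensity (profileDensity K β ρ μ))
    {x₀ : ℝ} (hx₀ : 0 < x₀) :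
    momentDensity K (β * (1 - ρ)) μ x₀ ≠ ∞ ∧
      ContinuousAt (momentDensity K (β * (1 - ρ)) μ) x₀ := by
  have := hμ.isLocallyFiniteMeasure
  have hatom (x : ℝ) : μ {x} = 0 := by
    rw [h]
    exact withDensity_absolutelyContinuous _ _ (measure_singleton x)
  obtain ⟨a, ha, M, hM, hMμ⟩ := hK.exists_restrict_Ioc_le hγ hC hρ hμ hβ
    (hK.measurable_profileDensity β ρ) rfl h (x₀ := x₀) (R := x₀ + 1) ⟨hx₀, lt_add_one x₀⟩
  obtain ⟨hfin, hcont⟩ := hK.flux_coagKer_ne_top_and_continuousAt hγ hC hρ hμ hatom ha.1.le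
    ⟨ha.2, lt_add_one x₀⟩ hM hMμ
  have hIio : μ (Iio x₀) ≠ ∞ :=
    ((measure_mono Iio_subset_Iic_self).trans_lt (hμ.Iic_lt_top x₀)).ne
  refine ⟨ENNReal.add_ne_top.2 ⟨hfin, ENNReal.mul_ne_top ENNReal.ofReal_ne_top hIio⟩, ?_⟩
  exact hcont.add (ENNReal.Tendsto.const_mul (hμ.continuousAt_measure_Iio hatom x₀)
    (Or.inr ENNReal.ofReal_ne_top))

end Density

/-- Any weak stationary solution satisfying the `𝒳_ρ`-type upper bound is, on `(0,∞)`,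
absolutely continuous with a continuous density. -/
theorem continuity_of_selfsimilar_profile
    (γ C ρ β : ℝ) (K : ℝ → ℝ → ℝ)
    (hγ : γ ∈ Ico (0:ℝ) 1) (hC : 0 < C) (hK : KernelHyp K γ C)
    (hρ : ρ ∈ Ioo γ 1) (hβ : β = 1 / (ρ - γ))
    (μ : Measure ℝ)
    (hsupp : μ (Iio 0) = 0)
    (hbd : ∀ R > (0:ℝ), μ (Icc 0 R) ≤ ENNReal.ofReal (R ^ (1 - ρ)))
    (hweak : ∀ ψ : ℝ → ℝ, ContDiff ℝ 1 ψ → HasCompactSupport ψ →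
      (∫ x in Ioi (0:ℝ), deriv ψ x * Imeas K μ x)
        - β * (∫ x, deriv (fun w => w * ψ w) x ∂μ)
        + β * ρ * (∫ x, ψ x ∂μ) = 0) :
    ∃ g : ℝ → ℝ,
      ContinuousOn g (Ioi 0) ∧
      (∀ x ∈ Ioi (0:ℝ), 0 ≤ g x) ∧
      μ.restrict (Ioi 0)
        = (volume.restrict (Ioi 0)).withDensity (fun x => ENNReal.ofReal (g x)) := by
  have hμ : PowerGrowth μ ρ := ⟨hsupp, hbd⟩
  have hβ0 : 0 < β := hβ ▸ one_div_pos.2 (sub_pos.2 hρ.1)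
  have h := hK.eq_withDensity_profileDensity hρ.2 hμ hβ0
    (hK.withDensity_mul_eq hγ hC hρ hμ hβ0 hweak)
  have hD (x : ℝ) (hx : 0 < x) :=
    hK.momentDensity_ne_top_and_continuousAt hγ hC hρ hμ hβ0 h hx
  refine ⟨fun x => (momentDensity K (β * (1 - ρ)) μ x).toReal / (β * x), fun x hx => ?_,
    fun x hx => div_nonneg ENNReal.toReal_nonneg (mul_nonneg hβ0.le (le_of_lt hx)), ?_⟩
  · refine ContinuousAt.continuousWithinAt (ContinuousAt.div ?_ (by fun_prop)
      (mul_pos hβ0 hx).ne')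
    exact (ENNReal.tendsto_toReal (hD x hx).1).comp (hD x hx).2
  · rw [Measure.restrict_eq_self_of_ae_mem (s := Ioi 0) (hμ.ae_pos hρ.2)]
    refine h.trans (withDensity_congr_ae ?_)
    filter_upwards [ae_restrict_mem measurableSet_Ioi] with x hx
    rw [ENNReal.ofReal_div_of_pos (mul_pos hβ0 hx), ENNReal.ofReal_toReal (hD x hx).1]
    rfl

end Smol
end
end

section
/- Let γ ∈ [0,1), let K satisfy the standing kernel assumptions, ρ ∈ (γ,1), β = 1/(ρ−γ), δ ∈ (0, ρ−γ), R₀ > 0. Let h be a continuous nonnegative function on (0,∞) which lies in the set 𝒴 (i.e. ∫_0^R h ≤ R^{1−ρ} and ∫_0^R h ≥ R^{1−ρ}(1−(R₀/R)^δ)₊ for all R > 0) and which satisfies, for all R > 0, the flux identity ∫_0^R ∫_{R−y}^∞ (K(y,z)/z) h(z) h(y) dz dy − β R h(R) − β(ρ−1) ∫_0^R h(x) dx = 0. Then h(x) x^ρ → 1−ρ as x → ∞, i.e. h(x) ∼ (1−ρ) x^{−(1+ρ)}·x in the mass variable, equivalently h(x)/((1−ρ)x^{−ρ}) → 1. -/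
open MeasureTheory Real Set Filter Topology

noncomputable section

namespace Smol

/-- Dyadic tail estimate: if `∫_0^R h ≤ R^{1-ρ}` then `∫_r^∞ z^{-a} h` converges for `a > 1-ρ`. -/
theorem exists_tail_bound {ρ a : ℝ} {h : ℝ → ℝ} (ha : 0 ≤ a) (haρ : 1 - ρ < a)
    (hnonneg : ∀ x ∈ Ioi (0:ℝ), 0 ≤ h x)
    (hint : ∀ R > (0:ℝ), IntegrableOn h (Ioc 0 R))
    (hupper : ∀ R > (0:ℝ), ∫ x in Ioc (0:ℝ) R, h x ≤ R ^ (1 - ρ)) :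
    ∃ A > (0:ℝ), ∀ r > (0:ℝ), IntegrableOn (fun z => z ^ (-a) * h z) (Ioi r) ∧
      ∫ z in Ioi r, z ^ (-a) * h z ≤ A * r ^ (1 - ρ - a) := by
  have hq : (2:ℝ) ^ (1 - ρ - a) < 1 := rpow_lt_one_of_one_lt_of_neg (by norm_num) (by linarith)
  have hA : 0 < (2:ℝ) ^ (1 - ρ) / (1 - 2 ^ (1 - ρ - a)) :=
    div_pos (by positivity) (by linarith)
  refine ⟨_, hA, fun r hr => ?_⟩
  set A : ℝ := (2:ℝ) ^ (1 - ρ) / (1 - 2 ^ (1 - ρ - a)) with hAdef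
  have hpos : ∀ z > (0:ℝ), 0 ≤ z ^ (-a) * h z := fun z hz =>
    mul_nonneg (rpow_nonneg hz.le _) (hnonneg z hz)
  have hbd : ∀ s > (0:ℝ), ∀ z ∈ Ioi s, z ^ (-a) ≤ s ^ (-a) := fun s hs z hz =>
    rpow_le_rpow_of_nonpos hs (le_of_lt hz) (by linarith)
  have hloc : ∀ s > 0, ∀ t, IntegrableOn (fun z => z ^ (-a) * h z) (Ioc s t) := by
    intro s hs t
    rcases le_or_gt t s with hts | hts
    · simp [Ioc_eq_empty_of_le hts]
    have h1 : IntegrableOn h (Ioc s t) :=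
      (hint t (hs.trans hts)).mono_set (Ioc_subset_Ioc_left hs.le)
    refine Integrable.bdd_mul (c := s ^ (-a)) h1 (by fun_prop) ?_
    refine (ae_restrict_iff' measurableSet_Ioc).2 (ae_of_all _ fun z hz => ?_)
    rw [norm_of_nonneg (rpow_nonneg (hs.trans hz.1).le _)]
    exact hbd s hs z hz.1
  have hpiece : ∀ s > 0, ∫ z in Ioc s (2 * s), z ^ (-a) * h z
      ≤ A * s ^ (1 - ρ - a) - A * (2 * s) ^ (1 - ρ - a) := by
    intro s hs
    have h1 : IntegrableOn h (Ioc s (2 * s)) :=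
      (hint (2 * s) (by linarith)).mono_set (Ioc_subset_Ioc_left hs.le)
    calc ∫ z in Ioc s (2 * s), z ^ (-a) * h z
        ≤ ∫ z in Ioc s (2 * s), s ^ (-a) * h z :=
          setIntegral_mono_on (hloc s hs _) (h1.const_mul _) measurableSet_Ioc fun z hz =>
            mul_le_mul_of_nonneg_right (hbd s hs z hz.1) (hnonneg z (hs.trans hz.1))
      _ = s ^ (-a) * ∫ z in Ioc s (2 * s), h z := integral_const_mul _ _
      _ ≤ s ^ (-a) * ∫ z in Ioc 0 (2 * s), h z := by
          refine mul_le_mul_of_nonneg_left ?_ (rpow_nonneg hs.le _)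
          exact setIntegral_mono_set (hint _ (by linarith))
            ((ae_restrict_iff' measurableSet_Ioc).2 (ae_of_all _ fun z hz => hnonneg z hz.1))
            (Ioc_subset_Ioc_left hs.le).eventuallyLE
      _ ≤ s ^ (-a) * (2 * s) ^ (1 - ρ) :=
          mul_le_mul_of_nonneg_left (hupper _ (by linarith)) (rpow_nonneg hs.le _)
      _ = A * s ^ (1 - ρ - a) - A * (2 * s) ^ (1 - ρ - a) := by
          have h2 : A * (1 - 2 ^ (1 - ρ - a)) = 2 ^ (1 - ρ) :=
            div_mul_cancel₀ _ (by linarith)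
          rw [mul_rpow (by norm_num) hs.le, mul_rpow (by norm_num) hs.le, ← h2,
            show 1 - ρ - a = -a + (1 - ρ) by ring, rpow_add hs]
          ring
  have hind : ∀ n : ℕ, ∫ z in r..2 ^ n * r, z ^ (-a) * h z
      ≤ A * r ^ (1 - ρ - a) - A * (2 ^ n * r) ^ (1 - ρ - a) := by
    intro n
    induction n with
    | zero => simp
    | succ n ih =>
      have hs : 0 < 2 ^ n * r := by positivity
      have hrs : r ≤ 2 ^ n * r := le_mul_of_one_le_left hr.le (one_le_pow₀ (by norm_num))
      have h2 : (2:ℝ) ^ (n + 1) * r = 2 * (2 ^ n * r) := by ring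
      have h3 := hpiece _ hs
      rw [h2, ← intervalIntegral.integral_add_adjacent_intervals
        (b := 2 ^ n * r)
        ((intervalIntegrable_iff_integrableOn_Ioc_of_le hrs).2 (hloc r hr _))
        ((intervalIntegrable_iff_integrableOn_Ioc_of_le (by linarith)).2 (hloc _ hs _)),
        intervalIntegral.integral_of_le (a := 2 ^ n * r) (by linarith)]
      linarith
  have hlim : Tendsto (fun n : ℕ => (2:ℝ) ^ n * r) atTop atTop :=
    (tendsto_pow_atTop_atTop_of_one_lt (by norm_num)).atTop_mul_const hr
  have hle : ∀ n : ℕ, ∫ z in r..2 ^ n * r, z ^ (-a) * h z ≤ A * r ^ (1 - ρ - a) := fun n =>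
    (hind n).trans (sub_le_self _ (by positivity))
  have hI : IntegrableOn (fun z => z ^ (-a) * h z) (Ioi r) := by
    refine integrableOn_Ioi_of_intervalIntegral_norm_bounded (A * r ^ (1 - ρ - a)) r
      (fun n : ℕ => hloc r hr _) hlim (Eventually.of_forall fun n => ?_)
    have hrs : r ≤ 2 ^ n * r := le_mul_of_one_le_left hr.le (one_le_pow₀ (by norm_num))
    refine le_of_eq_of_le ?_ (hle n)
    rw [intervalIntegral.integral_of_le hrs, intervalIntegral.integral_of_le hrs]
    exact setIntegral_congr_fun measurableSet_Ioc fun z hz =>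
      norm_of_nonneg (hpos z (hr.trans hz.1))
  exact ⟨hI, le_of_tendsto' (intervalIntegral_tendsto_integral_Ioi r hI hlim) hle⟩

/-- For fixed `y < R`, the inner integral of the flux is controlled by `R^γ (R-y)^{-ρ}`. -/
theorem exists_inner_flux_bound {γ C ρ : ℝ} {K : ℝ → ℝ → ℝ} {h : ℝ → ℝ}
    (hγ : γ ∈ Ico (0:ℝ) 1) (hC : 0 < C) (hK : KernelHyp K γ C) (hρ : ρ ∈ Ioo γ 1)
    (hnonneg : ∀ x ∈ Ioi (0:ℝ), 0 ≤ h x)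
    (hint : ∀ R > (0:ℝ), IntegrableOn h (Ioc 0 R))
    (hupper : ∀ R > (0:ℝ), ∫ x in Ioc (0:ℝ) R, h x ≤ R ^ (1 - ρ)) :
    ∃ D > (0:ℝ), ∀ R y : ℝ, 0 < y → y < R →
      ∫ z in Ioi (R - y), K y z / z * h z ≤ D * R ^ γ * (R - y) ^ (-ρ) := by
  obtain ⟨hγ0, hγ1⟩ := hγ
  obtain ⟨hργ, hρ1⟩ := hρ
  obtain ⟨A, hA, hA'⟩ := exists_tail_bound (ρ := ρ) (a := 1) zero_le_one (by linarith)
    hnonneg hint hupper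
  obtain ⟨B, hB, hB'⟩ := exists_tail_bound (ρ := ρ) (a := 1 - γ) (by linarith) (by linarith)
    hnonneg hint hupper
  refine ⟨C * (A + B), by positivity, fun R y hy hyR => ?_⟩
  have hr : 0 < R - y := by linarith
  obtain ⟨hAi, hAb⟩ := hA' _ hr
  obtain ⟨hBi, hBb⟩ := hB' _ hr
  have hAi' := hAi.const_mul (C * y ^ γ)
  have hBi' := hBi.const_mul C
  have hyγ : y ^ γ ≤ R ^ γ := rpow_le_rpow hy.le hyR.le hγ0
  have hrγ : (R - y) ^ γ ≤ R ^ γ := rpow_le_rpow hr.le (by linarith) hγ0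
  have hrρ : 0 ≤ (R - y) ^ (-ρ) := rpow_nonneg hr.le _
  have hy0 : 0 ≤ y ^ γ := rpow_nonneg hy.le _
  calc ∫ z in Ioi (R - y), K y z / z * h z
      ≤ ∫ z in Ioi (R - y), C * y ^ γ * (z ^ (-1:ℝ) * h z) + C * (z ^ (-(1 - γ)) * h z) := by
        refine integral_mono_of_nonneg ?_ (hAi'.add hBi') ?_
        · refine (ae_restrict_iff' measurableSet_Ioi).2 (ae_of_all _ fun z hz => ?_)
          have hz0 : 0 < z := hr.trans hz
          exact mul_nonneg (div_nonneg (hK.nonneg y z hy hz0) hz0.le) (hnonneg z hz0)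
        · refine (ae_restrict_iff' measurableSet_Ioi).2 (ae_of_all _ fun z hz => ?_)
          have hz0 : 0 < z := hr.trans hz
          have h1 : K y z / z ≤ C * (y ^ γ + z ^ γ) / z :=
            div_le_div_of_nonneg_right (hK.growth y z hy hz0) hz0.le
          have h2 : z ^ (-(1 - γ)) = z ^ γ * z⁻¹ := by
            rw [show -(1 - γ) = γ + -1 by ring, rpow_add hz0, rpow_neg_one]
          refine (mul_le_mul_of_nonneg_right h1 (hnonneg z hz0)).trans_eq ?_
          simp only [h2, rpow_neg_one]
          ring
    _ = C * y ^ γ * (∫ z in Ioi (R - y), z ^ (-1:ℝ) * h z)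
        + C * ∫ z in Ioi (R - y), z ^ (-(1 - γ)) * h z := by
        rw [integral_add hAi' hBi', integral_const_mul, integral_const_mul]
    _ ≤ C * y ^ γ * (A * (R - y) ^ (1 - ρ - 1))
        + C * (B * (R - y) ^ (1 - ρ - (1 - γ))) := by gcongr
    _ = C * (A * (y ^ γ * (R - y) ^ (-ρ)) + B * ((R - y) ^ γ * (R - y) ^ (-ρ))) := by
        rw [show 1 - ρ - 1 = -ρ by ring, show 1 - ρ - (1 - γ) = γ + -ρ by ring, rpow_add hr]
        ring
    _ ≤ C * (A * (R ^ γ * (R - y) ^ (-ρ)) + B * (R ^ γ * (R - y) ^ (-ρ))) := by gcongr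
    _ = C * (A + B) * R ^ γ * (R - y) ^ (-ρ) := by ring

/-- The flux through `R` is of lower order than `R^{1-ρ}`, as soon as `h(y) y^ρ` is bounded on
`[R/2, R]`. -/
theorem exists_flux_bound {γ C ρ : ℝ} {K : ℝ → ℝ → ℝ} {h : ℝ → ℝ}
    (hγ : γ ∈ Ico (0:ℝ) 1) (hC : 0 < C) (hK : KernelHyp K γ C) (hρ : ρ ∈ Ioo γ 1)
    (hnonneg : ∀ x ∈ Ioi (0:ℝ), 0 ≤ h x)
    (hint : ∀ R > (0:ℝ), IntegrableOn h (Ioc 0 R))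
    (hupper : ∀ R > (0:ℝ), ∫ x in Ioc (0:ℝ) R, h x ≤ R ^ (1 - ρ)) :
    ∃ E > (0:ℝ), ∀ R > (0:ℝ), ∀ M ≥ (0:ℝ), (∀ y ∈ Icc (R / 2) R, h y * y ^ ρ ≤ M) →
      (∫ y in Ioc (0:ℝ) R, (∫ z in Ioi (R - y), K y z / z * h z) * h y)
        ≤ E * R ^ (γ - ρ) * R ^ (1 - ρ) * (1 + M) := by
  obtain ⟨D, hD, hin⟩ := exists_inner_flux_bound hγ hC hK hρ hnonneg hint hupper
  have hρ0 : 0 < ρ := hγ.1.trans_lt hρ.1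
  have hρ1 : 0 < 1 - ρ := by linarith [hρ.2]
  refine ⟨D * 2 ^ ρ / (1 - ρ), by positivity, fun R hR M hM hb => ?_⟩
  have hR2 : 0 < R / 2 := by positivity
  have hsing : IntervalIntegrable (fun y => (R - y) ^ (-ρ)) volume 0 R := by
    simpa using ((intervalIntegral.intervalIntegrable_rpow' (a := 0) (b := R) (r := -ρ)
      (by linarith)).comp_sub_left R).symm
  have hval : ∫ y in Ioc 0 R, (R - y) ^ (-ρ) = R ^ (1 - ρ) / (1 - ρ) := by
    rw [← intervalIntegral.integral_of_le hR.le,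
      intervalIntegral.integral_comp_sub_left (fun y => y ^ (-ρ)) R,
      integral_rpow (Or.inl (by linarith))]
    rw [show -ρ + 1 = 1 - ρ by ring]
    simp [zero_rpow hρ1.ne']
  have hsing' := (intervalIntegrable_iff_integrableOn_Ioc_of_le hR.le).1 hsing
  have hi1 := (hint R hR).const_mul (D * R ^ γ * (R / 2) ^ (-ρ))
  have hi2 := hsing'.const_mul (D * R ^ γ * (R / 2) ^ (-ρ) * M)
  have hne : ∀ᵐ y ∂(volume.restrict (Ioc 0 R)), y ∈ Ioo 0 R := by
    rw [← restrict_Ioo_eq_restrict_Ioc]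
    exact ae_restrict_mem measurableSet_Ioo
  calc ∫ y in Ioc (0:ℝ) R, (∫ z in Ioi (R - y), K y z / z * h z) * h y
      ≤ ∫ y in Ioc (0:ℝ) R, D * R ^ γ * (R / 2) ^ (-ρ) * h y
          + D * R ^ γ * (R / 2) ^ (-ρ) * M * (R - y) ^ (-ρ) := by
        refine integral_mono_of_nonneg ?_ (hi1.add hi2) ?_
        · filter_upwards [hne] with y hy
          refine mul_nonneg (setIntegral_nonneg measurableSet_Ioi fun z hz => ?_)
            (hnonneg y hy.1)
          have hz0 : 0 < z := (sub_pos.2 hy.2).trans hz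
          exact mul_nonneg (div_nonneg (hK.nonneg y z hy.1 hz0) hz0.le) (hnonneg z hz0)
        · filter_upwards [hne] with y hy
          have hry : 0 < R - y := sub_pos.2 hy.2
          have hhy := hnonneg y hy.1
          have hc : 0 ≤ D * R ^ γ := by positivity
          have key : (R - y) ^ (-ρ) * h y
              ≤ (R / 2) ^ (-ρ) * h y + (R / 2) ^ (-ρ) * M * (R - y) ^ (-ρ) := by
            rcases le_total y (R / 2) with hy2 | hy2
            · have h1 : (R - y) ^ (-ρ) ≤ (R / 2) ^ (-ρ) :=
                rpow_le_rpow_of_nonpos hR2 (by linarith) (by linarith)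
              have h2 : 0 ≤ (R / 2) ^ (-ρ) * M * (R - y) ^ (-ρ) := by positivity
              linarith [mul_le_mul_of_nonneg_right h1 hhy]
            · have h1 : y ^ (-ρ) ≤ (R / 2) ^ (-ρ) :=
                rpow_le_rpow_of_nonpos hR2 hy2 (by linarith)
              have h2 : h y ≤ (R / 2) ^ (-ρ) * M := by
                calc h y = y ^ (-ρ) * (h y * y ^ ρ) := by
                      rw [mul_left_comm, ← rpow_add hy.1]; simp
                  _ ≤ y ^ (-ρ) * M :=
                      mul_le_mul_of_nonneg_left (hb y ⟨hy2, hy.2.le⟩) (rpow_nonneg hy.1.le _)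
                  _ ≤ (R / 2) ^ (-ρ) * M := mul_le_mul_of_nonneg_right h1 hM
              have h3 : 0 ≤ (R / 2) ^ (-ρ) * h y := by positivity
              linarith [mul_le_mul_of_nonneg_left h2 (rpow_nonneg hry.le (-ρ))]
          calc (∫ z in Ioi (R - y), K y z / z * h z) * h y
              ≤ D * R ^ γ * (R - y) ^ (-ρ) * h y :=
                mul_le_mul_of_nonneg_right (hin R y hy.1 hy.2) hhy
            _ = D * R ^ γ * ((R - y) ^ (-ρ) * h y) := by ring
            _ ≤ _ := mul_le_mul_of_nonneg_left key hc
            _ = _ := by ring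
    _ = D * R ^ γ * (R / 2) ^ (-ρ) * (∫ y in Ioc (0:ℝ) R, h y)
          + D * R ^ γ * (R / 2) ^ (-ρ) * M * (R ^ (1 - ρ) / (1 - ρ)) := by
        rw [integral_add hi1 hi2, integral_const_mul, integral_const_mul, hval]
    _ ≤ D * R ^ γ * (R / 2) ^ (-ρ) * (R ^ (1 - ρ) / (1 - ρ))
          + D * R ^ γ * (R / 2) ^ (-ρ) * M * (R ^ (1 - ρ) / (1 - ρ)) := by
        have h1 : R ^ (1 - ρ) ≤ R ^ (1 - ρ) / (1 - ρ) :=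
          le_div_self (rpow_nonneg hR.le _) hρ1 (by linarith)
        have h2 := (hupper R hR).trans h1
        gcongr
    _ = D * 2 ^ ρ / (1 - ρ) * R ^ (γ - ρ) * R ^ (1 - ρ) * (1 + M) := by
        rw [div_rpow hR.le (by norm_num), rpow_neg (by norm_num : (0:ℝ) ≤ 2),
          show γ - ρ = γ + -ρ by ring, rpow_add hR]
        field_simp

/-- Decay behaviour of continuous profiles in the set `𝒴` satisfying the flux identity:
`h(x)x^ρ → 1-ρ` as `x → ∞`, i.e. `h(x)/((1-ρ)x^{-ρ}) → 1`. -/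
theorem decay_of_selfsimilar_profile
    (γ C ρ β δ R₀ : ℝ) (K : ℝ → ℝ → ℝ) (h : ℝ → ℝ)
    (hγ : γ ∈ Ico (0:ℝ) 1) (hC : 0 < C) (hK : KernelHyp K γ C)
    (hρ : ρ ∈ Ioo γ 1) (hβ : β = 1 / (ρ - γ))
    (hδ : δ ∈ Ioo 0 (ρ - γ)) (hR₀ : 0 < R₀)
    (hcont : ContinuousOn h (Ioi 0))
    (hnonneg : ∀ x ∈ Ioi (0:ℝ), 0 ≤ h x)
    (hint : ∀ R > (0:ℝ), IntegrableOn h (Ioc 0 R))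
    (hupper : ∀ R > (0:ℝ), ∫ x in Ioc (0:ℝ) R, h x ≤ R ^ (1 - ρ))
    (hlower : ∀ R > (0:ℝ),
      R ^ (1 - ρ) * max (1 - (R₀ / R) ^ δ) 0 ≤ ∫ x in Ioc (0:ℝ) R, h x)
    (hflux : ∀ R > (0:ℝ),
      (∫ y in Ioc (0:ℝ) R, (∫ z in Ioi (R - y), K y z / z * h z) * h y)
        - β * R * h R - β * (ρ - 1) * (∫ x in Ioc (0:ℝ) R, h x) = 0) :
    Tendsto (fun x => h x / ((1 - ρ) * x ^ (-ρ))) atTop (𝓝 1) := by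
  obtain ⟨E, hE, hEb⟩ := exists_flux_bound hγ hC hK hρ hnonneg hint hupper
  have hργ : 0 < ρ - γ := sub_pos.2 hρ.1
  have hρ0 : 0 < ρ := hγ.1.trans_lt hρ.1
  have hρ1 : 0 < 1 - ρ := by linarith [hρ.2]
  have hβ0 : 0 < β := by rw [hβ]; positivity
  set F : ℝ → ℝ := fun R =>
    ∫ y in Ioc (0:ℝ) R, (∫ z in Ioi (R - y), K y z / z * h z) * h y with hF
  set H : ℝ → ℝ := fun R => ∫ x in Ioc (0:ℝ) R, h x with hH
  set g : ℝ → ℝ := fun R => h R * R ^ ρ with hg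
  have hpow : ∀ R > (0:ℝ), R ^ ρ = R * R ^ (ρ - 1) := fun R hR => by
    rw [rpow_sub_one hR.ne']; field_simp
  have hcancel : ∀ R > (0:ℝ), R ^ (1 - ρ) * R ^ (ρ - 1) = 1 := fun R hR => by
    rw [← rpow_add hR]; simp
  have hid : ∀ R > (0:ℝ), g R = (1 - ρ) * (H R * R ^ (ρ - 1)) + F R / β * R ^ (ρ - 1) := by
    intro R hR
    have h1 : R * h R = (1 - ρ) * H R + F R / β := by
      have h2 : F R - β * R * h R - β * (ρ - 1) * H R = 0 := hflux R hR
      field_simp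
      linarith
    calc g R = R * h R * R ^ (ρ - 1) := by simp only [hg, hpow R hR]; ring
      _ = _ := by rw [h1]; ring
  have hHle : ∀ R > (0:ℝ), H R * R ^ (ρ - 1) ≤ 1 := fun R hR =>
    (mul_le_mul_of_nonneg_right (hupper R hR) (rpow_nonneg hR.le _)).trans_eq (hcancel R hR)
  have hFnn : ∀ R > (0:ℝ), 0 ≤ F R := by
    intro R hR
    refine setIntegral_nonneg measurableSet_Ioc fun y hy => ?_
    refine mul_nonneg (setIntegral_nonneg measurableSet_Ioi fun z hz => ?_) (hnonneg y hy.1)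
    have hz0 : 0 < z := (sub_nonneg.2 hy.2).trans_lt hz
    exact mul_nonneg (div_nonneg (hK.nonneg y z hy.1 hz0) hz0.le) (hnonneg z hz0)
  have hFb : ∀ R > (0:ℝ), ∀ M ≥ (0:ℝ), (∀ y ∈ Icc (R / 2) R, g y ≤ M) →
      F R / β * R ^ (ρ - 1) ≤ E / β * R ^ (γ - ρ) * (1 + M) := by
    intro R hR M hM hb
    calc F R / β * R ^ (ρ - 1)
        ≤ E * R ^ (γ - ρ) * R ^ (1 - ρ) * (1 + M) / β * R ^ (ρ - 1) := by
          gcongr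
          exact hEb R hR M hM hb
      _ = E / β * R ^ (γ - ρ) * (1 + M) * (R ^ (1 - ρ) * R ^ (ρ - 1)) := by ring
      _ = _ := by rw [hcancel R hR, mul_one]
  have hsmall : Tendsto (fun R : ℝ => E / β * R ^ (γ - ρ)) atTop (𝓝 0) := by
    have := (tendsto_rpow_neg_atTop hργ).const_mul (E / β)
    simpa using this
  have hgcont : ContinuousOn g (Ioi 0) :=
    hcont.mul fun x hx => (continuousAt_rpow_const x ρ (Or.inl (ne_of_gt hx))).continuousWithinAt
  have hmax : ∀ T ≥ (1:ℝ), ∃ x ∈ Icc 1 T, ∀ y ∈ Icc 1 T, g y ≤ g x := fun T hT =>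
    isCompact_Icc.exists_isMaxOn (nonempty_Icc.2 hT)
      (hgcont.mono fun x hx => zero_lt_one.trans_le hx.1)
  have hgnn : ∀ x > (0:ℝ), 0 ≤ g x := fun x hx => mul_nonneg (hnonneg x hx) (rpow_nonneg hx.le _)
  obtain ⟨R₁, hR₁⟩ := eventually_atTop.1
    (hsmall.eventually_le_const (show (0:ℝ) < 1 / 2 by norm_num))
  obtain ⟨B, hB0, hB⟩ : ∃ B ≥ (0:ℝ), ∀ x ≥ (1:ℝ), g x ≤ B := by
    obtain ⟨x₁, hx₁, hx₁max⟩ := hmax (max R₁ 2) (le_max_of_le_right (by norm_num))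
    refine ⟨max (g x₁) 3, le_max_of_le_right (by norm_num), fun x hx => ?_⟩
    obtain ⟨s, hs, hsmax⟩ := hmax x hx
    refine (hsmax x ⟨hx, le_rfl⟩).trans ?_
    rcases le_or_gt s (max R₁ 2) with hs2 | hs2
    · exact le_max_of_le_left (hx₁max s ⟨hs.1, hs2⟩)
    · refine le_max_of_le_right ?_
      have hs0 : 0 < s := zero_lt_one.trans_le hs.1
      have hs3 : 2 < s := (le_max_right _ _).trans_lt hs2
      have h1 := hFb s hs0 (g s) (hgnn s hs0) fun y hy =>
        hsmax y ⟨by linarith [hy.1], hy.2.trans hs.2⟩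
      have h2 := hR₁ s ((le_max_left _ _).trans hs2.le)
      have h3 := mul_le_mul_of_nonneg_right h2 (show 0 ≤ 1 + g s by linarith [hgnn s hs0])
      have h4 := mul_le_mul_of_nonneg_left (hHle s hs0) hρ1.le
      linarith [hid s hs0]
  have hFlim : Tendsto (fun R => F R / β * R ^ (ρ - 1)) atTop (𝓝 0) := by
    refine tendsto_of_tendsto_of_tendsto_of_le_of_le' tendsto_const_nhds
      (by simpa using hsmall.mul_const (1 + B)) ?_ ?_
    · filter_upwards [eventually_gt_atTop 0] with R hR
      have := hFnn R hR
      positivity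
    · filter_upwards [eventually_ge_atTop 2] with R hR
      exact hFb R (by linarith) B hB0 fun y hy => hB y (by linarith [hy.1])
  have hHlim : Tendsto (fun R => H R * R ^ (ρ - 1)) atTop (𝓝 1) := by
    have h1 : Tendsto (fun R : ℝ => 1 - (R₀ / R) ^ δ) atTop (𝓝 1) := by
      have h2 : Tendsto (fun R : ℝ => R₀ / R) atTop (𝓝 0) := tendsto_const_nhds.div_atTop tendsto_id
      have h3 := (h2.rpow_const (Or.inr hδ.1.le) (p := δ)).const_sub 1
      simpa [zero_rpow hδ.1.ne'] using h3
    refine tendsto_of_tendsto_of_tendsto_of_le_of_le' h1 tendsto_const_nhds ?_ ?_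
    · filter_upwards [eventually_gt_atTop 0] with R hR
      calc 1 - (R₀ / R) ^ δ ≤ max (1 - (R₀ / R) ^ δ) 0 := le_max_left _ _
        _ = R ^ (1 - ρ) * max (1 - (R₀ / R) ^ δ) 0 * R ^ (ρ - 1) := by
            rw [mul_right_comm, hcancel R hR, one_mul]
        _ ≤ H R * R ^ (ρ - 1) :=
            mul_le_mul_of_nonneg_right (hlower R hR) (rpow_nonneg hR.le _)
    · filter_upwards [eventually_gt_atTop 0] with R hR using hHle R hR
  have hlim : Tendsto (fun R => ((1 - ρ) * (H R * R ^ (ρ - 1)) + F R / β * R ^ (ρ - 1)) / (1 - ρ))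
      atTop (𝓝 1) := by
    have := ((hHlim.const_mul (1 - ρ)).add hFlim).div_const (1 - ρ)
    simpa [div_self hρ1.ne'] using this
  refine hlim.congr' ?_
  filter_upwards [eventually_gt_atTop 0] with R hR
  rw [← hid R hR, rpow_neg hR.le]
  have : R ^ ρ ≠ 0 := (rpow_pos_of_pos hR ρ).ne'
  simp only [hg]
  field_simp

end Smol
end
end
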